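/- arXiv:2601.05571 — 4 statements merged into one kernel-verified Lean document; each statement's English description precedes it below -/
import Mathlib

section
/- (Strong Lefschetz property for cubic threefolds.) Let F ∈ ℂ[x₀,…,x₄] be a smooth cubic form. Then there exists a linear form ℓ ∈ S_1 such that for every k ∈ {0,1,2}, the multiplication map M(F)_k → M(F)_{5−k} induced by multiplication by ℓ^{5−2k} is a linear isomorphism, where M(F)_k = S_k/J_{F,k} and T = (n+1)(d−2) = 5. -/
open MvPolynomial

/-- `F` is smooth: the only common zero of its partial derivatives is the origin. -/
def SmoothForm {N : ℕ} (F : MvPolynomial (Fin N) ℂ) : Prop :=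
  ∀ x : Fin N → ℂ, (∀ i, eval x (pderiv i F) = 0) → x = 0

/-- The Jacobian ideal of `F`. -/
noncomputable def jacobianIdeal {N : ℕ} (F : MvPolynomial (Fin N) ℂ) :
    Ideal (MvPolynomial (Fin N) ℂ) :=
  Ideal.span (Set.range fun i => pderiv i F)


namespace SLP

/-- The polynomial ring in five variables. -/
abbrev P := MvPolynomial (Fin 5) ℂ

/-- `a` is a nonzerodivisor modulo `I`. -/
def NZ (a : P) (I : Ideal P) : Prop := ∀ u, a * u ∈ I → u ∈ I

lemma mem_sup_sing {I : Ideal P} {a u : P} : u ∈ I ⊔ Ideal.span {a} ↔ ∃ c, u - a * c ∈ I := by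
  rw [Submodule.mem_sup]
  constructor
  · rintro ⟨y, hy, z, hz, rfl⟩
    obtain ⟨c, rfl⟩ := Ideal.mem_span_singleton.1 hz
    exact ⟨c, by simpa using hy⟩
  · rintro ⟨c, hc⟩
    exact ⟨_, hc, a * c, Ideal.mem_span_singleton.2 ⟨c, rfl⟩, by ring⟩

/-- Ideal generated by the first `k` of the linear forms `a`. -/
noncomputable def Ak (a : ℕ → P) (k : ℕ) : Ideal P := Ideal.span (a '' Set.Iio k)

lemma Ak_succ (a : ℕ → P) (k : ℕ) : Ak a (k + 1) = Ak a k ⊔ Ideal.span {a k} := by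
  unfold Ak
  rw [← Ideal.span_union]
  congr 1
  ext x
  simp only [Set.mem_image, Set.mem_Iio, Set.mem_union, Set.mem_singleton_iff]
  constructor
  · rintro ⟨i, hi, rfl⟩
    rcases Nat.lt_succ_iff_lt_or_eq.1 hi with h | h
    · exact Or.inl ⟨i, h, rfl⟩
    · exact Or.inr (by rw [h])
  · rintro (⟨i, hi, rfl⟩ | rfl)
    · exact ⟨i, by omega, rfl⟩
    · exact ⟨k, by omega, rfl⟩

/-- Chains of generic elements of `W`. -/
inductive Ch (a : ℕ → P) (W : Submodule ℂ P) : ℕ → Submodule ℂ P → Prop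
  | zero : Ch a W 0 ⊥
  | succ (n : ℕ) (V : Submodule ℂ P) (g : P) : Ch a W n V → n ≤ 4 → g ∈ W →
      (∀ k, k + n ≤ 4 → NZ g (Ak a k ⊔ Ideal.span (V : Set P))) →
      Ch a W (n + 1) (V ⊔ Submodule.span ℂ {g})

lemma span_sup_sing (V : Submodule ℂ P) (g : P) :
    Ideal.span ((V ⊔ Submodule.span ℂ {g} : Submodule ℂ P) : Set P)
      = Ideal.span (V : Set P) ⊔ Ideal.span {g} := by
  apply le_antisymm
  · rw [Ideal.span_le]
    intro x hx
    obtain ⟨y, hy, z, hz, rfl⟩ := Submodule.mem_sup.1 hx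
    obtain ⟨c, rfl⟩ := Submodule.mem_span_singleton.1 hz
    refine Submodule.add_mem_sup (Ideal.subset_span hy) ?_
    rw [MvPolynomial.smul_eq_C_mul]
    exact Ideal.mul_mem_left _ _ (Ideal.subset_span rfl)
  · refine sup_le (Ideal.span_mono (fun x hx => Submodule.mem_sup_left hx)) ?_
    rw [Ideal.span_singleton_le_iff_mem]
    exact Ideal.subset_span (Submodule.mem_sup_right (Submodule.mem_span_singleton_self g))

section
variable {a : ℕ → P} {W : Submodule ℂ P}

lemma Ch.NA (ha : ∀ k ≤ 4, NZ (a k) (Ak a k)) {n : ℕ} {V : Submodule ℂ P} (h : Ch a W n V) :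
    ∀ k, k + n ≤ 4 → NZ (a k) (Ak a k ⊔ Ideal.span (V : Set P)) := by
  induction h with
  | zero =>
    intro k hk
    have : Ideal.span ((⊥ : Submodule ℂ P) : Set P) = ⊥ := by simp
    rw [this, sup_bot_eq]
    exact ha k hk
  | succ n V g hV hn hg hgz ih =>
    intro k hk u hu
    rw [span_sup_sing, ← sup_assoc, mem_sup_sing] at *
    obtain ⟨v, hv⟩ := hu
    have h1 : g * v ∈ Ak a (k+1) ⊔ Ideal.span (V : Set P) := by
      rw [Ak_succ, sup_right_comm, mem_sup_sing]
      refine ⟨u, ?_⟩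
      rw [← neg_mem_iff]
      simpa using hv
    have h2 := hgz (k+1) (by omega) v h1
    rw [Ak_succ, sup_right_comm, mem_sup_sing] at h2
    obtain ⟨v', hv'⟩ := h2
    refine ⟨v', ih k (by omega) _ ?_⟩
    have := add_mem hv (Ideal.mul_mem_left _ g hv')
    convert this using 1
    ring

lemma Ch.le {n : ℕ} {V : Submodule ℂ P} (h : Ch a W n V) : V ≤ W := by
  induction h with
  | zero => simp
  | succ n V g hV hn hg hgz ih => exact sup_le ih (by simpa using hg)

lemma Ch.finrank {n : ℕ} {V : Submodule ℂ P} (h : Ch a W n V)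
    (hW : Ideal.span (W : Set P) ≠ ⊤) : Module.Finite ℂ V ∧ Module.finrank ℂ V = n := by
  induction h with
  | zero => exact ⟨inferInstance, by simp⟩
  | succ n V g hV hn hg hgz ih =>
    obtain ⟨h1, h2⟩ := ih
    refine ⟨inferInstance, ?_⟩
    have hgV : g ∉ V := by
      intro hgV
      have := hgz 0 (by omega) 1 (by
        rw [mul_one]; exact Ideal.mem_sup_right (Ideal.subset_span hgV))
      have h0 : Ak a 0 = ⊥ := by simp [Ak]
      rw [h0, bot_sup_eq] at this
      apply hW
      rw [Ideal.eq_top_iff_one]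
      exact Ideal.span_mono hV.le this
    have hdis : V ⊓ Submodule.span ℂ {g} = ⊥ := by
      rw [← disjoint_iff]
      have hg0 : g ≠ 0 := fun h => hgV (h ▸ zero_mem _)
      exact (Submodule.disjoint_span_singleton' hg0).2 hgV
    have := Submodule.finrank_sup_add_finrank_inf_eq V (Submodule.span ℂ {g})
    have hg0 : g ≠ 0 := fun h => hgV (h ▸ zero_mem _)
    rw [hdis, finrank_span_singleton hg0, h2] at this
    simpa using this

/-- Generic choice of an element of `W` regular modulo finitely many ideals. -/
lemma pick (hW : idealOfVars (Fin 5) ℂ ≤ (Ideal.span (W : Set P)).radical)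
    {m : ℕ} (I : Fin m → Ideal P)
    (hI : ∀ k, ∀ u, (∀ z ∈ idealOfVars (Fin 5) ℂ, z * u ∈ I k) → u ∈ I k) :
    ∃ g ∈ W, ∀ k, NZ g (I k) := by
  classical
  let T : Set (Ideal P) := ⋃ k, associatedPrimes P (P ⧸ I k)
  have hT : T.Finite := Set.finite_iUnion fun k => associatedPrimes.finite P (P ⧸ I k)
  let q : Ideal P → Submodule ℂ W := fun p => (p.restrictScalars ℂ).comap W.subtype
  have hq : ∀ p ∈ T, q p ≠ ⊤ := by
    intro p hp htop
    obtain ⟨k, hk⟩ := Set.mem_iUnion.1 hp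
    have hprime := (IsAssociatedPrime.isPrime hk)
    have hWp : Ideal.span (W : Set P) ≤ p := by
      rw [Ideal.span_le]
      intro w hw
      have : (⟨w, hw⟩ : W) ∈ q p := by rw [htop]; trivial
      exact this
    have hmp : idealOfVars (Fin 5) ℂ ≤ p := hW.trans (hprime.radical_le_iff.2 hWp)
    rw [AssociatedPrimes.mem_iff, isAssociatedPrime_iff] at hk
    obtain ⟨_, x, hx⟩ := hk
    obtain ⟨u, rfl⟩ := Ideal.Quotient.mk_surjective x
    have : u ∈ I k := by
      apply hI k u
      intro z hz
      have := hmp hz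
      rw [hx, Submodule.mem_colon_singleton] at this
      rw [← Ideal.Quotient.eq_zero_iff_mem]
      exact this
    apply hprime.ne_top
    rw [hx, Ideal.eq_top_iff_one, Submodule.mem_colon_singleton]
    simpa [Ideal.Quotient.eq_zero_iff_mem] using this
  have := Subspace.biUnion_ne_univ_of_top_notMem (k := ℂ) (E := W) (s := hT.toFinset.image q) (by
    simp only [Finset.mem_image, Set.Finite.mem_toFinset, not_exists, not_and]
    exact hq)
  rw [Set.ne_univ_iff_exists_notMem] at this
  obtain ⟨g, hg⟩ := this
  refine ⟨g, g.2, fun k u hu => ?_⟩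
  by_contra hcon
  apply hg
  have h1 : (g : P) ∈ { r : P | ∃ x : P ⧸ I k, x ≠ 0 ∧ r • x = 0 } := by
    refine ⟨Ideal.Quotient.mk _ u, ?_, ?_⟩
    · rwa [Ne, Ideal.Quotient.eq_zero_iff_mem]
    · have := Ideal.Quotient.eq_zero_iff_mem.2 hu
      exact this
  rw [← biUnion_associatedPrimes_eq_zero_divisors] at h1
  simp only [Set.mem_iUnion] at h1
  obtain ⟨p, hp, hgp⟩ := h1
  simp only [Set.mem_iUnion]
  refine ⟨q p, ?_, hgp⟩
  simp only [Finset.mem_image, Set.Finite.mem_toFinset]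
  exact ⟨p, Set.mem_iUnion.2 ⟨k, hp⟩, rfl⟩

lemma exists_Ch (ha : ∀ k ≤ 4, NZ (a k) (Ak a k)) (hm : Ak a 5 = idealOfVars (Fin 5) ℂ)
    (hW : idealOfVars (Fin 5) ℂ ≤ (Ideal.span (W : Set P)).radical) (n : ℕ) (hn : n ≤ 5) :
    ∃ V, Ch a W n V := by
  induction n with
  | zero => exact ⟨_, Ch.zero⟩
  | succ n ih =>
    obtain ⟨V, hV⟩ := ih (by omega)
    obtain ⟨g, hg, hgz⟩ := pick hW (m := 5 - n)
      (fun k => Ak a k ⊔ Ideal.span (V : Set P)) (by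
        intro k u hu
        refine hV.NA ha k (by omega) u (hu _ ?_)
        rw [← hm]
        exact Ideal.subset_span ⟨k, by simp only [Set.mem_Iio]; omega, rfl⟩)
    exact ⟨_, Ch.succ n V g hV (by omega) hg (fun k hk => hgz ⟨k, by omega⟩)⟩

end
end SLP

namespace SLP
/-- Homogeneous ideal, via components. -/
def HI (I : Ideal P) : Prop := ∀ u ∈ I, ∀ d, homogeneousComponent d u ∈ I

/-- Forms of degree `d`. -/
noncomputable abbrev Sd (d : ℕ) : Submodule ℂ P := homogeneousSubmodule (Fin 5) ℂ d

section
attribute [local instance] MvPolynomial.gradedAlgebra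

lemma HI_span (s : Set P) (hs : ∀ x ∈ s, ∃ n, x ∈ Sd n) :
    HI (Ideal.span s) := by
  intro u hu d
  have h := Ideal.homogeneous_span (homogeneousSubmodule (Fin 5) ℂ) s (fun x hx => hs x hx)
  exact homogeneousComponent_mem_of_mem h hu d

lemma hc_mul {g : P} {i : ℕ} (hg : g ∈ Sd i) (v : P) (n : ℕ) :
    homogeneousComponent n (g * v) =
      if i ≤ n then g * homogeneousComponent (n - i) v else 0 := by
  have := DirectSum.coe_decompose_mul_of_left_mem (𝒜 := homogeneousSubmodule (Fin 5) ℂ)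
    (b := v) n hg
  rw [← decomposition.decompose'_apply, ← decomposition.decompose'_apply]
  exact this
end

lemma hc_self {u : P} {d : ℕ} (hu : u ∈ Sd d) : homogeneousComponent d u = u :=
  homogeneousComponent_eq_self hu

lemma step {I0 : Ideal P} (hI0 : HI I0) {g b u : P} {d : ℕ} (hg : g ∈ Sd 2) (hb : b ∈ Sd 1)
    (hgz : NZ g I0) (hu : u ∈ Sd d) (hbu : b * u ∈ I0 ⊔ Ideal.span {g}) :
    ∃ v ∈ Sd (d - 1), (d = 0 → v = 0) ∧ b * u - g * v ∈ I0 ∧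
      ∀ c, c * u ∈ I0 ⊔ Ideal.span {g} → c * v ∈ I0 ⊔ Ideal.span {b} := by
  obtain ⟨v0, hv0⟩ := mem_sup_sing.1 hbu
  have h1 := hI0 _ hv0 (d + 1)
  have hbu' : b * u ∈ Sd (d + 1) := by
    rw [add_comm]; exact hb.mul hu
  rw [map_sub, hc_self hbu', hc_mul hg] at h1
  have key : ∀ v, b * u - g * v ∈ I0 →
      ∀ c, c * u ∈ I0 ⊔ Ideal.span {g} → c * v ∈ I0 ⊔ Ideal.span {b} := by
    intro v hv c hc
    obtain ⟨w, hw⟩ := mem_sup_sing.1 hc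
    rw [mem_sup_sing]
    refine ⟨w, hgz _ ?_⟩
    have := sub_mem (Ideal.mul_mem_left _ b hw) (Ideal.mul_mem_left _ c hv)
    convert this using 1
    ring
  split_ifs at h1 with h
  · have e : d + 1 - 2 = d - 1 := by omega
    rw [e] at h1
    exact ⟨_, homogeneousComponent_mem _ _, fun h => by omega, h1, key _ h1⟩
  · have h2 : b * u - g * 0 ∈ I0 := by simpa using h1
    exact ⟨0, zero_mem _, fun _ => rfl, h2, key _ h2⟩

lemma back {I0 : Ideal P} {g b u v : P} (hbz : NZ b I0) (h : b * u - g * v ∈ I0)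
    (hv : v ∈ I0 ⊔ Ideal.span {b}) : u ∈ I0 ⊔ Ideal.span {g} := by
  obtain ⟨s, hs⟩ := mem_sup_sing.1 hv
  rw [mem_sup_sing]
  refine ⟨s, hbz _ ?_⟩
  have := add_mem h (Ideal.mul_mem_left _ g hs)
  convert this using 1
  ring

section
variable {a : ℕ → P} {W : Submodule ℂ P}

lemma HI_Ch (ha1 : ∀ k, a k ∈ Sd 1) (hW2 : W ≤ Sd 2) {V : Submodule ℂ P} (hV : V ≤ W) (k : ℕ) :
    HI (Ak a k ⊔ Ideal.span (V : Set P)) := by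
  unfold Ak
  rw [← Ideal.span_union]
  apply HI_span
  rintro x (⟨i, _, rfl⟩ | hx)
  · exact ⟨1, ha1 i⟩
  · exact ⟨2, hW2 (hV hx)⟩

lemma eq_right (V : Submodule ℂ P) (k : ℕ) :
    Ak a k ⊔ Ideal.span (V : Set P) ⊔ Ideal.span {a k} = Ak a (k + 1) ⊔ Ideal.span (V : Set P) := by
  rw [Ak_succ, sup_right_comm]

variable (ha : ∀ k ≤ 4, NZ (a k) (Ak a k)) (ha1 : ∀ k, a k ∈ Sd 1) (hW2 : W ≤ Sd 2)
  (hm : Ak a 5 = idealOfVars (Fin 5) ℂ)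

include ha ha1 hW2 in
lemma claimP2 {n : ℕ} {V : Submodule ℂ P} (h : Ch a W n V) :
    ∀ k, k + n = 5 → ∀ d, d + k ≤ 4 → ∀ u ∈ Sd d,
      (∀ i ≤ d + k, a i * u ∈ Ak a k ⊔ Ideal.span (V : Set P)) →
      u ∈ Ak a k ⊔ Ideal.span (V : Set P) := by
  induction h with
  | zero => intro k hk d hd; omega
  | succ n V g hV hn hg hgz ih =>
    intro k hk d hd u hu hau
    rw [span_sup_sing, ← sup_assoc] at *
    obtain ⟨v, hv, hv0, h1, h2⟩ := step (HI_Ch ha1 hW2 hV.le k) (hW2 hg) (ha1 k)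
      (hgz k (by omega)) hu (hau k (by omega))
    refine back (hV.NA ha k (by omega)) h1 ?_
    rcases Nat.eq_zero_or_pos d with hd0 | hd0
    · rw [hv0 hd0]; exact zero_mem _
    · rw [eq_right] at *
      exact ih (k + 1) (by omega) (d - 1) (by omega) v hv
        (fun i hi => h2 _ (hau i (by omega)))

include hm in
lemma Sd_le_A5 {d : ℕ} (hd : 0 < d) {u : P} (hu : u ∈ Sd d) : u ∈ Ak a 5 := by
  rw [hm]
  rw [show idealOfVars (Fin 5) ℂ = (idealOfVars (Fin 5) ℂ) ^ 1 by rw [pow_one],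
    mem_pow_idealOfVars_iff]
  intro m hm'
  have := hu (mem_support_iff.1 hm')
  rw [Finsupp.degree_eq_weight_one]
  exact hd.trans_eq this.symm

include ha ha1 hW2 hm in
lemma claimTop {n : ℕ} {V : Submodule ℂ P} (h : Ch a W n V) :
    ∀ k, k + n = 5 → ∀ d, 5 < d + k → ∀ u ∈ Sd d,
      (∀ i < 5, a i * u ∈ Ak a k ⊔ Ideal.span (V : Set P)) →
      u ∈ Ak a k ⊔ Ideal.span (V : Set P) := by
  induction h with
  | zero =>
    intro k hk d hd u hu _
    obtain rfl : k = 5 := by omega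
    exact Ideal.mem_sup_left (Sd_le_A5 hm (by omega) hu)
  | succ n V g hV hn hg hgz ih =>
    intro k hk d hd u hu hau
    rw [span_sup_sing, ← sup_assoc] at *
    obtain ⟨v, hv, hv0, h1, h2⟩ := step (HI_Ch ha1 hW2 hV.le k) (hW2 hg) (ha1 k)
      (hgz k (by omega)) hu (hau k (by omega))
    refine back (hV.NA ha k (by omega)) h1 ?_
    rw [eq_right] at *
    exact ih (k + 1) (by omega) (d - 1) (by omega) v hv
        (fun i hi => h2 _ (hau i (by omega)))

include ha ha1 hW2 in
lemma claimDim {n : ℕ} {V : Submodule ℂ P} (h : Ch a W n V) :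
    ∀ k, k + n = 5 → ∀ d, d + k = 5 → ∀ u ∈ Sd d, ∀ u' ∈ Sd d,
      (∀ i < 5, a i * u ∈ Ak a k ⊔ Ideal.span (V : Set P)) →
      (∀ i < 5, a i * u' ∈ Ak a k ⊔ Ideal.span (V : Set P)) →
      ∃ c c' : ℂ, ¬ (c = 0 ∧ c' = 0) ∧ C c * u + C c' * u' ∈ Ak a k ⊔ Ideal.span (V : Set P) := by
  induction h with
  | zero =>
    intro k hk d hd u hu u' hu' _ _
    obtain rfl : d = 0 := by omega
    obtain ⟨s, rfl⟩ : ∃ s, u = C s := ⟨_, totalDegree_eq_zero_iff_eq_C.1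
      (Nat.le_zero.1 (IsHomogeneous.totalDegree_le hu))⟩
    obtain ⟨s', rfl⟩ : ∃ s, u' = C s := ⟨_, totalDegree_eq_zero_iff_eq_C.1
      (Nat.le_zero.1 (IsHomogeneous.totalDegree_le hu'))⟩
    by_cases h0 : s = 0
    · exact ⟨1, 0, by simp, by simp [h0]⟩
    · refine ⟨s', -s, by simp [h0], ?_⟩
      rw [← C_mul, ← C_mul, ← C_add]
      have : s' * s + -s * s' = 0 := by ring
      rw [this, C_0]
      exact zero_mem _
  | succ n V g hV hn hg hgz ih =>
    intro k hk d hd u hu u' hu' hau hau'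
    rw [span_sup_sing, ← sup_assoc] at *
    obtain ⟨v, hv, hv0, h1, h2⟩ := step (HI_Ch ha1 hW2 hV.le k) (hW2 hg) (ha1 k)
      (hgz k (by omega)) hu (hau k (by omega))
    obtain ⟨v', hv', hv0', h1', h2'⟩ := step (HI_Ch ha1 hW2 hV.le k) (hW2 hg) (ha1 k)
      (hgz k (by omega)) hu' (hau' k (by omega))
    rw [eq_right] at *
    obtain ⟨c, c', hc, hcc⟩ := ih (k + 1) (by omega) (d - 1) (by omega) v hv v' hv'
        (fun i hi => h2 _ (hau i (by omega))) (fun i hi => h2' _ (hau' i (by omega)))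
    refine ⟨c, c', hc, ?_⟩
    rw [← eq_right] at hcc
    refine back (hV.NA ha k (by omega)) (v := C c * v + C c' * v') ?_ hcc
    have := add_mem (Ideal.mul_mem_left _ (C c) h1) (Ideal.mul_mem_left _ (C c') h1')
    convert this using 1
    ring
end
end SLP

namespace SLP

/-- Linear form with given coefficients. -/
noncomputable def L : (Fin 5 → ℂ) →ₗ[ℂ] P := Fintype.linearCombination ℂ (fun i => (X i : P))

lemma L_apply (v : Fin 5 → ℂ) : L v = ∑ i, v i • (X i : P) := rfl

lemma L_single (j : Fin 5) : L (Pi.single j 1) = X j := by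
  simp [L_apply, Pi.single_apply]

lemma L_mem (v : Fin 5 → ℂ) : L v ∈ Sd 1 := by
  rw [L_apply]
  exact Submodule.sum_mem _ fun i _ => Submodule.smul_mem _ _ (isHomogeneous_X ℂ i)

lemma NZ_X (k : Fin 5) : NZ (X k) (Ideal.span ((X : Fin 5 → P) '' Set.Iio k)) := by
  intro u hu
  rw [mem_ideal_span_X_image] at *
  intro m hm
  obtain ⟨i, hi, h⟩ := hu (m + Finsupp.single k 1) (by
    rw [mem_support_iff, add_comm, coeff_X_mul]; exact mem_support_iff.1 hm)
  refine ⟨i, hi, ?_⟩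
  have : i ≠ k := ne_of_lt hi
  simpa [Finsupp.single_apply, this.symm] using h

section
variable (b : Module.Basis (Fin 5) ℂ (Fin 5 → ℂ))

/-- Linear change of coordinates. -/
noncomputable def chg : P ≃ₐ[ℂ] P := AlgEquiv.ofAlgHom
  (aeval fun i => L (b i)) (aeval fun j => L (b.repr (Pi.single j 1))) (by
    ext1 j
    simp only [AlgHom.comp_apply, aeval_X, AlgHom.id_apply]
    rw [L_apply, map_sum]
    simp only [map_smul, aeval_X]
    simp only [← map_smul, ← map_sum]
    rw [b.sum_repr, L_single]) (by
    ext1 j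
    simp only [AlgHom.comp_apply, aeval_X, AlgHom.id_apply]
    rw [L_apply, map_sum]
    simp only [map_smul, aeval_X]
    rw [← L_single j]
    have : (b.repr (∑ i, b j i • Pi.single i 1) : Fin 5 → ℂ) = Pi.single j 1 := by
      rw [show (∑ i, b j i • Pi.single i (1:ℂ)) = b j by
        ext l; simp [Finset.sum_apply, Pi.single_apply]]
      rw [b.repr_self]; ext l; simp [Finsupp.single_apply, Pi.single_apply, eq_comm]
    rw [← this]
    simp only [← map_smul, ← map_sum]
    congr 1
    ext l
    simp)

/-- The sequence of linear forms attached to a basis. -/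
noncomputable def sq (k : ℕ) : P := if h : k < 5 then L (b ⟨k, h⟩) else 0

lemma sq_mem (k : ℕ) : sq b k ∈ Sd 1 := by
  unfold sq; split_ifs
  · exact L_mem _
  · exact zero_mem _

lemma sq_val (k : Fin 5) : sq b k = L (b k) := by
  unfold sq; simp

lemma chg_X (k : Fin 5) : chg b (X k) = sq b k := by
  simp [chg, sq_val]

lemma sq_NZ (k : ℕ) (hk : k ≤ 4) : NZ (sq b k) (Ak (sq b) k) := by
  obtain ⟨k, rfl⟩ : ∃ k' : Fin 5, k = k' := ⟨⟨k, by omega⟩, rfl⟩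
  have h : Ak (sq b) k = (Ideal.span ((X : Fin 5 → P) '' Set.Iio k)).comap (chg b).symm.toRingEquiv := by
    rw [← Ideal.map_symm]
    unfold Ak
    rw [Ideal.map_span, ← Set.image_comp]
    congr 1
    ext x
    constructor
    · rintro ⟨i, hi, rfl⟩
      simp only [Set.mem_Iio] at hi
      refine ⟨⟨i, by omega⟩, hi, ?_⟩
      exact chg_X b _
    · rintro ⟨i, hi, rfl⟩
      exact ⟨i, hi, (chg_X b _).symm⟩
  intro u hu
  rw [h] at *
  rw [Ideal.mem_comap, map_mul] at hu
  rw [← chg_X] at hu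
  apply NZ_X k
  have e : (chg b).symm.toRingEquiv ((chg b) (X k)) = X k := (chg b).symm_apply_apply _
  rw [e] at hu
  exact hu

lemma mem_iv {d : ℕ} (hd : 0 < d) {u : P} (hu : u ∈ Sd d) : u ∈ idealOfVars (Fin 5) ℂ := by
  rw [show idealOfVars (Fin 5) ℂ = (idealOfVars (Fin 5) ℂ) ^ 1 by rw [pow_one],
    mem_pow_idealOfVars_iff]
  intro m hm'
  have := hu (mem_support_iff.1 hm')
  rw [Finsupp.degree_eq_weight_one]
  exact hd.trans_eq this.symm

lemma sq_A5 : Ak (sq b) 5 = idealOfVars (Fin 5) ℂ := by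
  apply le_antisymm
  · unfold Ak
    rw [Ideal.span_le]
    rintro _ ⟨i, -, rfl⟩
    exact mem_iv one_pos (sq_mem b i)
  · unfold idealOfVars
    rw [Ideal.span_le]
    rintro _ ⟨j, rfl⟩
    rw [← L_single, ← b.sum_repr (Pi.single j 1), map_sum]
    refine Ideal.sum_mem _ fun i _ => ?_
    rw [map_smul, smul_eq_C_mul, ← sq_val]
    exact Ideal.mul_mem_left _ _ (Ideal.subset_span ⟨i, by simp, rfl⟩)

end

/-- Any subspace of dimension at least `r` contains the first `r` vectors of some basis. -/
lemma exists_basis (U : Submodule ℂ (Fin 5 → ℂ)) (r : ℕ) (hr : r ≤ Module.finrank ℂ U) :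
    ∃ b : Module.Basis (Fin 5) ℂ (Fin 5 → ℂ), ∀ i : Fin 5, (i : ℕ) < r → b i ∈ U := by
  obtain ⟨U', hU'⟩ := U.exists_isCompl
  have hs := Submodule.finrank_add_eq_of_isCompl hU'
  rw [Module.finrank_fin_fun] at hs
  let b1 := Module.finBasis ℂ U
  let b2 := Module.finBasis ℂ U'
  let e := (b1.prod b2).map (Submodule.prodEquivOfIsCompl U U' hU')
  let b := e.reindex (finSumFinEquiv.trans (finCongr hs))
  refine ⟨b, fun i hi => ?_⟩
  have : b i = b1 ⟨i, by omega⟩ := by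
    have h2 : (finSumFinEquiv.trans (finCongr hs)).symm i = Sum.inl ⟨i, by omega⟩ := by
      rw [Equiv.symm_apply_eq]; ext; simp
    simp only [b, Module.Basis.reindex_apply, h2, e]
    simp
  rw [this]
  exact Subtype.mem _
end SLP

namespace SLP
section
variable {W : Submodule ℂ P} (hW2 : W ≤ Sd 2) (hfin : Module.Finite ℂ W)
  (hr : Module.finrank ℂ W ≤ 5) (hZ : ∀ x : Fin 5 → ℂ, (∀ w ∈ W, eval x w = 0) → x = 0)

include hZ in
lemma rad : idealOfVars (Fin 5) ℂ ≤ (Ideal.span (W : Set P)).radical := by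
  rw [← MvPolynomial.vanishingIdeal_zeroLocus_eq_radical (K := ℂ)]
  unfold idealOfVars
  rw [Ideal.span_le]
  rintro _ ⟨j, rfl⟩
  rw [SetLike.mem_coe, mem_vanishingIdeal_iff]
  intro x hx
  rw [mem_zeroLocus_iff] at hx
  have : x = 0 := hZ x (fun w hw => by
    have := hx w (Ideal.subset_span hw)
    rwa [aeval_eq_eval] at this)
  simp [this]

include hW2 in
lemma J_le : Ideal.span (W : Set P) ≤ idealOfVars (Fin 5) ℂ := by
  rw [Ideal.span_le]
  intro w hw
  exact mem_iv two_pos (hW2 hw)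

lemma iv_ne : (1 : P) ∉ idealOfVars (Fin 5) ℂ := by
  rw [show idealOfVars (Fin 5) ℂ = (idealOfVars (Fin 5) ℂ) ^ 1 by rw [pow_one],
    mem_pow_idealOfVars_iff]
  intro h
  have := h 0 (by simp)
  simp at this

include hW2 in
lemma one_notMem : (1 : P) ∉ Ideal.span (W : Set P) := fun h => iv_ne (J_le hW2 h)

include hW2 hfin hr hZ in
lemma exists_V (b : Module.Basis (Fin 5) ℂ (Fin 5 → ℂ)) : Ch (sq b) W 5 W := by
  obtain ⟨V, hV⟩ := exists_Ch (W := W) (sq_NZ b) (sq_A5 b) (rad hZ) 5 le_rfl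
  have h := hV.finrank (by
    rw [Ne, Ideal.eq_top_iff_one]; exact one_notMem hW2)
  have : V = W := Submodule.eq_of_le_of_finrank_le hV.le (by omega)
  rwa [this] at hV

lemma A0 (a : ℕ → P) : Ak a 0 ⊔ Ideal.span (W : Set P) = Ideal.span (W : Set P) := by
  simp [Ak]

include hW2 hfin hr hZ in
lemma JP2 {j : ℕ} (hj : j ≤ 4) {w : P} (hw : w ∈ Sd j) (hwJ : w ∉ Ideal.span (W : Set P))
    (U : Submodule ℂ (Fin 5 → ℂ)) (hU : ∀ v ∈ U, L v * w ∈ Ideal.span (W : Set P)) :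
    Module.finrank ℂ U ≤ j := by
  by_contra hcon
  obtain ⟨b, hb⟩ := exists_basis U (j + 1) (by omega)
  have h := claimP2 (sq_NZ b) (sq_mem b) hW2 (exists_V hW2 hfin hr hZ b) 0 rfl j (by omega) w hw
  rw [A0] at h
  apply hwJ
  apply h
  intro i hi
  have := hU _ (hb ⟨i, by omega⟩ (by simp; omega))
  rwa [← sq_val] at this

include hW2 hfin hr hZ in
lemma JTop {d : ℕ} (hd : 5 < d) {u : P} (hu : u ∈ Sd d)
    (h : ∀ v, L v * u ∈ Ideal.span (W : Set P)) : u ∈ Ideal.span (W : Set P) := by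
  let b := Pi.basisFun ℂ (Fin 5)
  have := claimTop (sq_NZ b) (sq_mem b) hW2 (sq_A5 b) (exists_V hW2 hfin hr hZ b) 0 rfl d
    (by omega) u hu
  rw [A0] at this
  apply this
  intro i hi
  have := h (b ⟨i, hi⟩)
  rwa [← sq_val] at this

include hW2 hfin hr hZ in
lemma JDim {u u' : P} (hu : u ∈ Sd 5) (hu' : u' ∈ Sd 5)
    (h : ∀ v, L v * u ∈ Ideal.span (W : Set P)) (h' : ∀ v, L v * u' ∈ Ideal.span (W : Set P)) :
    ∃ c c' : ℂ, ¬ (c = 0 ∧ c' = 0) ∧ c • u + c' • u' ∈ Ideal.span (W : Set P) := by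
  let b := Pi.basisFun ℂ (Fin 5)
  have := claimDim (sq_NZ b) (sq_mem b) hW2 (exists_V hW2 hfin hr hZ b) 0 rfl 5
    rfl u hu u' hu'
  rw [A0] at this
  simp only [smul_eq_C_mul]
  apply this
  · intro i hi
    have := h (b ⟨i, hi⟩)
    rwa [← sq_val] at this
  · intro i hi
    have := h' (b ⟨i, hi⟩)
    rwa [← sq_val] at this

include hW2 hfin hr hZ in
lemma J6 {d : ℕ} (hd : 5 < d) {u : P} (hu : u ∈ Sd d) : u ∈ Ideal.span (W : Set P) := by
  obtain ⟨N, hN⟩ := Ideal.exists_pow_le_of_le_radical_of_fg (rad hZ) (IsNoetherian.noetherian _)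
  have key : ∀ m d, 5 < d → N ≤ d + m → ∀ u ∈ Sd d, u ∈ Ideal.span (W : Set P) := by
    intro m
    induction m with
    | zero =>
      intro d hd hNd u hu
      apply hN
      rw [mem_pow_idealOfVars_iff]
      intro m hm
      have := hu (mem_support_iff.1 hm)
      rw [Finsupp.degree_eq_weight_one]
      exact le_trans hNd this.ge
    | succ m ih =>
      intro d hd hNd u hu
      apply JTop hW2 hfin hr hZ hd hu
      intro v
      refine ih (d + 1) (by omega) (by omega) _ ?_
      rw [add_comm]
      exact (L_mem v).mul hu
  exact key N d hd (by omega) u hu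

end
end SLP

namespace SLP

/-- The abstract properties of the graded Artinian Gorenstein algebra used in the second part. -/
structure SD (A : Type*) [CommRing A] [Algebra ℂ A] (R : ℕ → Submodule ℂ A)
    (l : (Fin 5 → ℂ) →ₗ[ℂ] A) (I : A →ₗ[ℂ] ℂ) : Prop where
  one_ne : (1 : A) ≠ 0
  one_mem : (1 : A) ∈ R 0
  mul_mem : ∀ {i j : ℕ} {a b : A}, a ∈ R i → b ∈ R j → a * b ∈ R (i + j)
  fin : ∀ k, Module.Finite ℂ (R k)
  l_mem : ∀ v, l v ∈ R 1
  l_surj : ∀ r ∈ R 1, ∃ v, l v = r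
  P2 : ∀ {j : ℕ}, j ≤ 4 → ∀ {w : A}, w ∈ R j → w ≠ 0 → ∀ U : Submodule ℂ (Fin 5 → ℂ),
    (∀ v ∈ U, l v * w = 0) → Module.finrank ℂ U ≤ j
  inj5 : ∀ u ∈ R 5, I u = 0 → u = 0
  pair : ∀ {k m : ℕ}, k + m = 5 → ∀ w ∈ R k, (∀ z ∈ R m, w * z = 0) → w = 0
  dim2 : Module.finrank ℂ (R 2) ≤ 10
  R0 : ∀ r ∈ R 0, ∃ c : ℂ, r = algebraMap ℂ A c

lemma finrank_Sd2 : Module.finrank ℂ (Sd 2) ≤ 15 := by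
  let f : Sym2 (Fin 5) → P := Sym2.lift ⟨fun i j => X i * X j, fun i j => mul_comm _ _⟩
  have h : Sd 2 ≤ Submodule.span ℂ (Set.range f) := by
    unfold Sd
    rw [← homogeneousSubmodule_one_pow, homogeneousSubmodule_one_eq_span_X, pow_two,
      Submodule.span_mul_span]
    apply Submodule.span_mono
    rintro _ ⟨_, ⟨i, rfl⟩, _, ⟨j, rfl⟩, rfl⟩
    exact ⟨s(i, j), rfl⟩
  have h2 := finrank_range_le_card (R := ℂ) f
  have : Module.Finite ℂ (Submodule.span ℂ (Set.range f)) := 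
    Module.Finite.span_of_finite ℂ (Set.finite_range f)
  refine (Submodule.finrank_mono h).trans (h2.trans ?_)
  rw [Sym2.card]
  simp [Nat.choose]

section
variable {W : Submodule ℂ P} (hW2 : W ≤ Sd 2) (hfin : Module.Finite ℂ W)
  (hr : Module.finrank ℂ W ≤ 5) (hZ : ∀ x : Fin 5 → ℂ, (∀ w ∈ W, eval x w = 0) → x = 0)

include hW2 hfin hr hZ in
lemma Jpair : ∀ m k, k + m = 5 → ∀ w ∈ Sd k, (∀ z ∈ Sd m, w * z ∈ Ideal.span (W : Set P)) →
    w ∈ Ideal.span (W : Set P) := by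
  intro m
  induction m with
  | zero => intro k hk w hw h; simpa using h 1 (isHomogeneous_one _ _)
  | succ m ih =>
    intro k hk w hw h
    by_contra hcon
    have h1 : ∀ v, L v * w ∈ Ideal.span (W : Set P) := by
      intro v
      refine ih (k + 1) (by omega) _ ?_ ?_
      · rw [add_comm]; exact (L_mem v).mul hw
      · intro z hz
        have := h (L v * z) (by rw [add_comm]; exact (L_mem v).mul hz)
        convert this using 1; ring
    have := JP2 hW2 hfin hr hZ (by omega) hw hcon ⊤ (fun v _ => h1 v)
    simp at this
    omega

/-- The graded pieces of the quotient. -/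
noncomputable def Rk (W : Submodule ℂ P) (k : ℕ) : Submodule ℂ (P ⧸ Ideal.span (W : Set P)) :=
  (Sd k).map (Ideal.Quotient.mkₐ ℂ (Ideal.span (W : Set P))).toLinearMap

/-- Linear forms in the quotient. -/
noncomputable def Lk (W : Submodule ℂ P) : (Fin 5 → ℂ) →ₗ[ℂ] (P ⧸ Ideal.span (W : Set P)) :=
  (Ideal.Quotient.mkₐ ℂ (Ideal.span (W : Set P))).toLinearMap ∘ₗ L

lemma mem_Rk {k : ℕ} {r : P ⧸ Ideal.span (W : Set P)} :
    r ∈ Rk W k ↔ ∃ u ∈ Sd k, Ideal.Quotient.mk _ u = r := Iff.rfl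

lemma Sd_fin (k : ℕ) : Module.Finite ℂ (Sd k) :=
  Module.Finite.iff_fg.2 (homogeneousSubmodule_fg (Fin 5) ℂ k)

include hW2 hfin hr hZ in
lemma Rdim2 : Module.finrank ℂ (Rk W 2) ≤ 10 := by
  have h5 : Module.finrank ℂ W = 5 := ((exists_V hW2 hfin hr hZ (Pi.basisFun ℂ (Fin 5))).finrank (by
    rw [Ne, Ideal.eq_top_iff_one]; exact one_notMem hW2)).2
  have := Sd_fin 2
  let f : Sd 2 →ₗ[ℂ] (P ⧸ Ideal.span (W : Set P)) :=
    (Ideal.Quotient.mkₐ ℂ (Ideal.span (W : Set P))).toLinearMap ∘ₗ (Sd 2).subtype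
  have h1 := f.finrank_range_add_finrank_ker
  have h2 : LinearMap.range f = Rk W 2 := by
    rw [LinearMap.range_comp, Submodule.range_subtype]; rfl
  have h3 : Module.finrank ℂ W ≤ Module.finrank ℂ (LinearMap.ker f) := by
    let g : W →ₗ[ℂ] LinearMap.ker f := LinearMap.codRestrict _ (Submodule.inclusion hW2) (by
      intro c
      rw [LinearMap.mem_ker]
      exact Ideal.Quotient.eq_zero_iff_mem.2 (Ideal.subset_span c.2))
    apply LinearMap.finrank_le_finrank_of_injective (f := g)
    intro c c' hcc
    have := congrArg (fun z : LinearMap.ker f => ((z : Sd 2) : P)) hcc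
    exact Subtype.ext this
  have := finrank_Sd2
  rw [h2] at h1
  omega

include hW2 hfin hr hZ in
theorem exists_SD : ∃ I, SD (P ⧸ Ideal.span (W : Set P)) (Rk W) (Lk W) I := by
  have hpair : ∀ {k m : ℕ}, k + m = 5 → ∀ w ∈ Rk W k, (∀ z ∈ Rk W m, w * z = 0) → w = 0 := by
    intro k m hkm w hw h
    obtain ⟨u, hu, rfl⟩ := mem_Rk.1 hw
    rw [Ideal.Quotient.eq_zero_iff_mem]
    refine Jpair hW2 hfin hr hZ m k hkm u hu fun z hz => ?_
    rw [← Ideal.Quotient.eq_zero_iff_mem, map_mul]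
    exact h _ (mem_Rk.2 ⟨z, hz, rfl⟩)
  have h1 : (1 : P ⧸ Ideal.span (W : Set P)) ≠ 0 := by
    rw [Ne, ← map_one (Ideal.Quotient.mk _), Ideal.Quotient.eq_zero_iff_mem]
    exact one_notMem hW2
  have h1m : (1 : P ⧸ Ideal.span (W : Set P)) ∈ Rk W 0 :=
    mem_Rk.2 ⟨1, isHomogeneous_one _ _, map_one _⟩
  obtain ⟨u0, hu0, hne⟩ : ∃ u ∈ Rk W 5, u ≠ 0 := by
    by_contra hcon
    push Not at hcon
    exact h1 (hpair (m := 5) rfl 1 h1m fun z hz => by rw [one_mul]; exact hcon z hz)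
  obtain ⟨I, hI⟩ : ∃ I : Module.Dual ℂ (P ⧸ Ideal.span (W : Set P)), I u0 ≠ 0 := by
    by_contra hcon
    push Not at hcon
    exact hne ((Module.forall_dual_apply_eq_zero_iff ℂ u0).1 hcon)
  refine ⟨I, h1, h1m, ?_, ?_, ?_, ?_, ?_, ?_, hpair, Rdim2 hW2 hfin hr hZ, ?_⟩
  · intro i j a b ha hb
    obtain ⟨u, hu, rfl⟩ := mem_Rk.1 ha
    obtain ⟨u', hu', rfl⟩ := mem_Rk.1 hb
    exact mem_Rk.2 ⟨u * u', hu.mul hu', map_mul _ _ _⟩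
  · intro k
    have := Sd_fin k
    unfold Rk
    infer_instance
  · intro v
    exact mem_Rk.2 ⟨L v, L_mem v, rfl⟩
  · intro r hr
    obtain ⟨u, hu, rfl⟩ := mem_Rk.1 hr
    unfold Sd at hu
    rw [homogeneousSubmodule_one_eq_span_X, Submodule.mem_span_range_iff_exists_fun] at hu
    obtain ⟨c, rfl⟩ := hu
    exact ⟨c, rfl⟩
  · intro j hj w hw hne U hU
    obtain ⟨u, hu, rfl⟩ := mem_Rk.1 hw
    rw [Ne, Ideal.Quotient.eq_zero_iff_mem] at hne
    refine JP2 hW2 hfin hr hZ hj hu hne U fun v hv => ?_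
    rw [← Ideal.Quotient.eq_zero_iff_mem, map_mul]
    exact hU v hv
  · intro u hu hIu
    obtain ⟨p, hp, rfl⟩ := mem_Rk.1 hu
    obtain ⟨p0, hp0, rfl⟩ := mem_Rk.1 hu0
    have hk : ∀ q ∈ Sd 5, ∀ v, L v * q ∈ Ideal.span (W : Set P) := fun q hq v =>
      J6 hW2 hfin hr hZ (d := 1 + 5) (by omega) ((L_mem v).mul hq)
    obtain ⟨c, c', hc, hcc⟩ := JDim hW2 hfin hr hZ hp hp0 (hk p hp) (hk p0 hp0)
    have h0 : c • Ideal.Quotient.mk (Ideal.span (W : Set P)) p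
        + c' • Ideal.Quotient.mk (Ideal.span (W : Set P)) p0 = 0 :=
      Ideal.Quotient.eq_zero_iff_mem.2 hcc
    have h2 := congrArg I h0
    rw [map_add, map_smul, map_smul, hIu, map_zero, smul_zero, zero_add, smul_eq_mul] at h2
    have hc' : c' = 0 := (mul_eq_zero.1 h2).resolve_right hI
    rw [hc', zero_smul, add_zero] at h0
    exact (smul_eq_zero.1 h0).resolve_left fun h => hc ⟨h, hc'⟩
  · intro r hr
    obtain ⟨u, hu, rfl⟩ := mem_Rk.1 hr
    refine ⟨_, congrArg (Ideal.Quotient.mk _) (totalDegree_eq_zero_iff_eq_C.1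
      (Nat.le_zero.1 (IsHomogeneous.totalDegree_le hu)))⟩
end
end SLP

namespace SLP
section
variable {A : Type*} [CommRing A] [Algebra ℂ A] 

/-- Specialization at a point. -/
noncomputable def ev (t : Fin 5 → ℂ) : MvPolynomial (Fin 5) A →+* A :=
  eval (fun i => algebraMap ℂ A (t i))

/-- Apply a functional to the coefficients. -/
noncomputable def hat (φ : A →ₗ[ℂ] ℂ) (p : MvPolynomial (Fin 5) A) : P :=
  ∑ m ∈ p.support, monomial m (φ (coeff m p))

lemma coeff_hat (φ : A →ₗ[ℂ] ℂ) (p : MvPolynomial (Fin 5) A) (m : Fin 5 →₀ ℕ) :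
    coeff m (hat φ p) = φ (coeff m p) := by
  classical
  unfold hat
  rw [coeff_sum]
  simp only [coeff_monomial]
  rw [Finset.sum_ite_eq']
  split_ifs with h
  · rfl
  · rw [notMem_support_iff.1 h, map_zero]

lemma eval_hat (φ : A →ₗ[ℂ] ℂ) (p : MvPolynomial (Fin 5) A) (t : Fin 5 → ℂ) :
    eval t (hat φ p) = φ (ev t p) := by
  unfold hat ev
  rw [map_sum, eval_eq, map_sum]
  refine Finset.sum_congr rfl fun m _ => ?_
  rw [eval_monomial]
  simp only [← map_pow, ← map_prod]
  rw [mul_comm (coeff m p), ← Algebra.smul_def, map_smul, smul_eq_mul, mul_comm]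
  rfl

lemma hat_sum {ι : Type*} [Fintype ι] (φ : A →ₗ[ℂ] ℂ) (Y : ι → P)
    (p : ι → MvPolynomial (Fin 5) A) :
    hat φ (∑ a, map (algebraMap ℂ A) (Y a) * p a) = ∑ a, Y a * hat φ (p a) := by
  classical
  ext m
  rw [coeff_hat]
  simp only [coeff_sum, map_sum, coeff_mul, coeff_hat, coeff_map]
  simp only [← Algebra.smul_def, map_smul, smul_eq_mul]

lemma exists_eval {q : P} (hq : q ≠ 0) : ∃ t, eval t q ≠ 0 := by
  by_contra hcon
  push Not at hcon
  exact hq (MvPolynomial.funext fun t => by rw [hcon t, map_zero])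

lemma gen_ne {p : MvPolynomial (Fin 5) A} (hp : p ≠ 0) :
    ∃ q : P, q ≠ 0 ∧ ∀ t, eval t q ≠ 0 → ev t p ≠ 0 := by
  obtain ⟨m, hm⟩ := ne_zero_iff.1 hp
  obtain ⟨φ, hφ⟩ : ∃ φ : Module.Dual ℂ A, φ (coeff m p) ≠ 0 := by
    by_contra hcon
    push Not at hcon
    exact hm ((Module.forall_dual_apply_eq_zero_iff ℂ _).1 hcon)
  refine ⟨hat φ p, fun h => hφ ?_, fun t ht h => ht ?_⟩
  · rw [← coeff_hat, h, coeff_zero]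
  · rw [eval_hat, h, map_zero]

variable {R : ℕ → Submodule ℂ A} {l : (Fin 5 → ℂ) →ₗ[ℂ] A} {I : A →ₗ[ℂ] ℂ}

/-- Polynomials with coefficients of degree `k`. -/
def Q (R : ℕ → Submodule ℂ A) (k : ℕ) (p : MvPolynomial (Fin 5) A) : Prop := ∀ m, coeff m p ∈ R k

lemma Q_C {k : ℕ} {r : A} (hr : r ∈ R k) : Q R k (C r) := by
  classical
  intro m
  rw [coeff_C]; split_ifs
  · exact hr
  · exact zero_mem _

lemma Q_sum {ι : Type*} {s : Finset ι} {k : ℕ} {p : ι → MvPolynomial (Fin 5) A}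
    (h : ∀ i ∈ s, Q R k (p i)) : Q R k (∑ i ∈ s, p i) := by
  intro m
  rw [coeff_sum]
  exact Submodule.sum_mem _ fun i hi => h i hi m

lemma Q_mapmul {k : ℕ} {p : MvPolynomial (Fin 5) A} (hp : Q R k p) (Y : P) :
    Q R k (map (algebraMap ℂ A) Y * p) := by
  classical
  intro m
  rw [coeff_mul]
  refine Submodule.sum_mem _ fun i _ => ?_
  rw [coeff_map, ← Algebra.smul_def]
  exact Submodule.smul_mem _ _ (hp _)

/-- Directional derivatives. -/
noncomputable def D : (Fin 5 → ℂ) →ₗ[ℂ]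
    Derivation A (MvPolynomial (Fin 5) A) (MvPolynomial (Fin 5) A) :=
  Fintype.linearCombination ℂ (fun i => pderiv i)

lemma D_apply (v : Fin 5 → ℂ) (p : MvPolynomial (Fin 5) A) : D v p = ∑ i, v i • pderiv i p := by
  unfold D
  rw [Fintype.linearCombination_apply]
  have := congrFun (map_sum Derivation.coeFnAddMonoidHom
    (fun i => v i • (pderiv i : Derivation A (MvPolynomial (Fin 5) A) (MvPolynomial (Fin 5) A)))
    Finset.univ) p
  rw [Finset.sum_apply] at this
  exact this

lemma Q_D {k : ℕ} {p : MvPolynomial (Fin 5) A} (hp : Q R k p) (v : Fin 5 → ℂ) : Q R k (D v p) := by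
  rw [D_apply]
  apply Q_sum
  intro i _ m
  rw [coeff_smul, coeff_pderiv]
  apply Submodule.smul_mem
  rw [mul_comm]
  have : ((m i : A) + 1) * coeff (m + Finsupp.single i 1) p
    = (m i + 1) • coeff (m + Finsupp.single i 1) p := by
      rw [nsmul_eq_mul]; push_cast; ring
  rw [this]
  exact Submodule.smul_of_tower_mem _ _ (hp _)

/-- The generic linear form. -/
noncomputable def ell (l : (Fin 5 → ℂ) →ₗ[ℂ] A) : MvPolynomial (Fin 5) A :=
  ∑ i, X i * C (l (Pi.single i 1))

lemma l_eq (l : (Fin 5 → ℂ) →ₗ[ℂ] A) (v : Fin 5 → ℂ) : l v = ∑ i, v i • l (Pi.single i 1) := by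
  conv_lhs => rw [pi_eq_sum_univ' v]
  rw [map_sum]
  refine Finset.sum_congr rfl fun i _ => ?_
  rw [map_smul]

lemma D_ell (v : Fin 5 → ℂ) : D v (ell l) = C (l v) := by
  rw [D_apply, l_eq l v, map_sum]
  refine Finset.sum_congr rfl fun i _ => ?_
  unfold ell
  rw [map_sum, Finset.sum_eq_single i]
  · rw [Derivation.leibniz, pderiv_C, pderiv_X_self, smul_zero, zero_add, smul_eq_mul, mul_one]
    rw [Algebra.smul_def, Algebra.smul_def, map_mul]
    rfl
  · intro j _ hj
    rw [Derivation.leibniz, pderiv_C, pderiv_X_of_ne hj, smul_zero, smul_zero, zero_add]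
  · simp

lemma ev_ell (t : Fin 5 → ℂ) : ev t (ell l) = l t := by
  rw [l_eq l t]
  simp [ev, ell, Algebra.smul_def]

lemma ev_C (t : Fin 5 → ℂ) (r : A) : ev t (C r) = r := by simp [ev]

lemma ev_mem {k : ℕ} {p : MvPolynomial (Fin 5) A} (hp : Q R k p) (t : Fin 5 → ℂ) :
    ev t p ∈ R k := by
  unfold ev
  rw [eval_eq]
  refine Submodule.sum_mem _ fun m _ => ?_
  simp only [← map_pow, ← map_prod]
  rw [mul_comm, ← Algebra.smul_def]
  exact Submodule.smul_mem _ _ (hp m)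

variable (h : SD A R l I)
include h

lemma SD.Q_mul {i j k : ℕ} (hk : i + j = k) {p q : MvPolynomial (Fin 5) A} (hp : Q R i p)
    (hq : Q R j q) : Q R k (p * q) := by
  classical
  subst hk
  intro m
  rw [coeff_mul]
  exact Submodule.sum_mem _ fun i _ => h.mul_mem (hp _) (hq _)

lemma SD.Q_pow {p : MvPolynomial (Fin 5) A} (hp : Q R 1 p) (n : ℕ) : Q R n (p ^ n) := by
  induction n with
  | zero => rw [pow_zero]; exact Q_C h.one_mem
  | succ n ih => rw [pow_succ]; exact h.Q_mul rfl ih hp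

lemma SD.Q_ell : Q R 1 (ell l) := by
  classical
  unfold ell
  apply Q_sum
  intro i _ m
  rw [mul_comm, coeff_C_mul, coeff_X, mul_ite, mul_one, mul_zero]
  split_ifs
  · exact h.l_mem _
  · exact zero_mem _

lemma SD.P1 {j : ℕ} (hj : j ≤ 4) {w : A} (hw : w ∈ R j) (hv : ∀ v, l v * w = 0) : w = 0 := by
  by_contra hne
  have := h.P2 hj hw hne ⊤ (fun v _ => hv v)
  simp at this
  omega

lemma SD.QP1 {j : ℕ} (hj : j ≤ 4) {w : MvPolynomial (Fin 5) A} (hw : Q R j w)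
    (hv : ∀ v, C (l v) * w = 0) : w = 0 := by
  ext m
  rw [coeff_zero]
  refine h.P1 hj (hw m) fun v => ?_
  rw [← coeff_C_mul, hv v, coeff_zero]

lemma SD.l_inj : Function.Injective l := by
  rw [← LinearMap.ker_eq_bot, ← Submodule.finrank_eq_zero (R := ℂ)]
  have := h.P2 (j := 0) (by omega) h.one_mem h.one_ne (LinearMap.ker l) (fun v hv => by
    rw [LinearMap.mem_ker.1 hv, zero_mul])
  omega

end
end SLP

namespace SLP
section
variable {A : Type*} [CommRing A] [Algebra ℂ A] 
variable {R : ℕ → Submodule ℂ A} {l : (Fin 5 → ℂ) →ₗ[ℂ] A} {I : A →ₗ[ℂ] ℂ}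
variable (h : SD A R l I)
include h

lemma SD.mat {k s m : ℕ} (hm : k + s = m) (hs : m + k = 5) (N : MvPolynomial (Fin 5) A)
    (hN : Q R s N) (hbad : ∀ y, Q R k y → N * y = 0 → y = 0) :
    ∃ q : P, q ≠ 0 ∧ ∀ t, eval t q ≠ 0 → ∀ z ∈ R k, ev t N * z = 0 → z = 0 := by
  classical
  have := h.fin k
  let e := Module.finBasis ℂ (R k)
  have hrep : ∀ z ∈ R k, ∃ c : Fin (Module.finrank ℂ (R k)) → ℂ, z = ∑ b, c b • (e b : A) := by
    intro z hz
    refine ⟨e.repr ⟨z, hz⟩, ?_⟩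
    have := congrArg (fun z : R k => (z : A)) (e.sum_repr ⟨z, hz⟩)
    simp only [Submodule.coe_sum, Submodule.coe_smul] at this
    exact this.symm
  have hli : ∀ c : Fin (Module.finrank ℂ (R k)) → ℂ, ∑ b, c b • (e b : A) = 0 → ∀ b, c b = 0 := by
    intro c hc
    apply Fintype.linearIndependent_iff.1 e.linearIndependent
    apply Subtype.ext
    simpa using hc
  let B : Matrix (Fin (Module.finrank ℂ (R k))) (Fin (Module.finrank ℂ (R k))) P :=
    fun a b => hat I (N * C (e a : A) * C (e b : A))
  refine ⟨B.det, ?_, ?_⟩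
  · intro hdet
    obtain ⟨Y, hY0, hY⟩ := Matrix.exists_mulVec_eq_zero_iff.2 hdet
    let y : MvPolynomial (Fin 5) A := ∑ b, map (algebraMap ℂ A) (Y b) * C (e b : A)
    have hyQ : Q R k y := Q_sum fun b _ => Q_mapmul (Q_C (e b).2) _
    have h1 : ∀ a, N * C (e a : A) * y = 0 := by
      intro a
      have h2 : hat I (N * C (e a : A) * y) = 0 := by
        have : N * C (e a : A) * y
            = ∑ b, map (algebraMap ℂ A) (Y b) * (N * C (e a : A) * C (e b : A)) := by
          simp only [y, Finset.mul_sum]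
          exact Finset.sum_congr rfl fun b _ => by ring
        rw [this, hat_sum]
        have := congrFun hY a
        simp only [Matrix.mulVec, dotProduct, Pi.zero_apply] at this
        rw [← this]
        exact Finset.sum_congr rfl fun b _ => mul_comm _ _
      have hq : Q R 5 (N * C (e a : A) * y) :=
        h.Q_mul hs (h.Q_mul (by omega) hN (Q_C (e a).2)) hyQ
      ext m'
      rw [coeff_zero]
      apply h.inj5 _ (hq m')
      rw [← coeff_hat, h2, coeff_zero]
    have hNy : N * y = 0 := by
      have hq : Q R m (N * y) := h.Q_mul (by omega) hN hyQ
      ext m'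
      rw [coeff_zero]
      refine h.pair hs _ (hq m') fun z hz => ?_
      obtain ⟨c, rfl⟩ := hrep z hz
      rw [Finset.mul_sum]
      refine Finset.sum_eq_zero fun b _ => ?_
      have : coeff m' (N * y) * (e b : A) = coeff m' (N * C (e b : A) * y) := by
        rw [mul_comm, ← coeff_C_mul]; congr 1; ring
      rw [mul_smul_comm, this, h1 b, coeff_zero, smul_zero]
    have hy0 := hbad y hyQ hNy
    apply hY0
    funext b
    ext m'
    rw [Pi.zero_apply, coeff_zero]
    refine hli (fun b => coeff m' (Y b)) ?_ b
    have := congrArg (coeff m') hy0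
    rw [coeff_zero] at this
    rw [← this]
    simp only [y, coeff_sum]
    refine Finset.sum_congr rfl fun b _ => ?_
    rw [mul_comm, coeff_C_mul, coeff_map, mul_comm, Algebra.smul_def]
  · intro t ht z hz hzN
    obtain ⟨c, rfl⟩ := hrep z hz
    have hdet : (B.map (eval t)).det ≠ 0 := by
      rw [← RingHom.mapMatrix_apply, ← RingHom.map_det]; exact ht
    have hc : c = 0 := by
      apply Matrix.eq_zero_of_mulVec_eq_zero hdet
      funext a
      have h0 : I (ev t N * (e a : A) * ∑ b, c b • (e b : A)) = 0 := by
        rw [mul_right_comm, hzN, zero_mul, map_zero]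
      rw [Pi.zero_apply, ← h0, Finset.mul_sum, map_sum]
      simp only [Matrix.mulVec, dotProduct, Matrix.map_apply]
      refine Finset.sum_congr rfl fun b _ => ?_
      simp only [B]
      rw [eval_hat, RingHom.map_mul, RingHom.map_mul, ev_C, ev_C, mul_smul_comm, map_smul, smul_eq_mul, mul_comm]
    simp [hc]

lemma SD.ell_ne : ∀ n ≤ 5, (ell l) ^ n ≠ 0 := by
  intro n
  induction n with
  | zero =>
    intro _ h0
    rw [pow_zero, ← C_1, C_eq_zero] at h0
    exact h.one_ne h0
  | succ n ih =>
    intro hn h0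
    apply ih (by omega)
    refine h.QP1 (j := n) (by omega) (h.Q_pow h.Q_ell n) fun v => ?_
    have h1 := congrArg (D v) h0
    rw [Derivation.leibniz_pow, map_zero, D_ell, Nat.add_sub_cancel, smul_eq_mul, mul_comm,
      ← Nat.cast_smul_eq_nsmul ℂ, smul_eq_zero] at h1
    exact h1.resolve_left (by exact_mod_cast Nat.succ_ne_zero n)

lemma D1 {y : MvPolynomial (Fin 5) A} {a b : ℕ} (h0 : ell l ^ (a + 1) * y ^ (b + 1) = 0)
    (v : Fin 5 → ℂ) : ((a : ℂ) + 1) • (ell l ^ a * C (l v) * y ^ (b + 1)) +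
      ((b : ℂ) + 1) • (ell l ^ (a + 1) * y ^ b * D v y) = 0 := by
  have h1 := congrArg (D v) h0
  rw [Derivation.leibniz, Derivation.leibniz_pow, Derivation.leibniz_pow, map_zero, D_ell] at h1
  simp only [Nat.add_sub_cancel, smul_eq_mul, nsmul_eq_mul] at h1
  rw [← h1, Algebra.smul_def, Algebra.smul_def]
  push_cast
  ring

lemma SD.D2 {y : MvPolynomial (Fin 5) A} (hy : Q R 1 y) {a b : ℕ} (hab : a + b + 2 ≤ 4)
    (h0 : ell l ^ (a + 1) * y ^ (b + 1) = 0) : ell l ^ a * y ^ (b + 2) = 0 := by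
  refine h.QP1 (j := a + (b + 2)) hab (h.Q_mul rfl (h.Q_pow h.Q_ell _) (h.Q_pow hy _)) fun v => ?_
  have h1 := congrArg (· * y) (D1 h h0 v)
  simp only [zero_mul, add_mul, smul_mul_assoc] at h1
  have h2 : ell l ^ (a + 1) * y ^ b * D v y * y = 0 := by
    rw [← zero_mul (D v y), ← h0]; ring
  rw [h2, smul_zero, add_zero, smul_eq_zero] at h1
  rw [← h1.resolve_left (by exact_mod_cast Nat.succ_ne_zero a)]
  ring

/-- The dimension count for the map `R_1 → R_4`. -/
lemma SD.count1 {i : ℕ} (hi : i + 1 ≤ 3) (t : Fin 5 → ℂ) {y w : A} (hy : y ∈ R 1)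
    (hw : w ∈ R (i + 1)) (hw0 : w ≠ 0) (τ : (Fin 5 → ℂ) →ₗ[ℂ] A) (hτ : ∀ v, τ v ∈ R 1)
    (hwy : y * w = 0) (hwl : l t * w = 0) (hwτ : ∀ v, τ v * w = 0) (h5 : (l t) ^ 5 ≠ 0)
    (hly : l t ^ (i + 1) * y = 0) (hw1 : l t ^ i * y ≠ 0)
    (hrel : ∀ v, ((i : ℂ) + 1) • (l t ^ i * l v * y) + l t ^ (i + 1) * τ v = 0) : False := by
  let Φ : (ℂ × ℂ × (Fin 5 → ℂ)) →ₗ[ℂ] A :=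
    (LinearMap.toSpanSingleton ℂ A y).coprod ((LinearMap.toSpanSingleton ℂ A (l t)).coprod τ)
  have hΦ : ∀ α β v, Φ (α, β, v) = α • y + (β • l t + τ v) := fun α β v => rfl
  let U : Submodule ℂ (Fin 5 → ℂ) := LinearMap.ker ((LinearMap.mulRight ℂ w) ∘ₗ l)
  have hU : Module.finrank ℂ U ≤ i + 1 := h.P2 (by omega) hw hw0 U fun v hv => hv
  let U1 : Submodule ℂ (Fin 5 → ℂ) := LinearMap.ker ((LinearMap.mulRight ℂ (l t ^ i * y)) ∘ₗ l)
  have hpow : ∀ n, l t ^ n ∈ R n := by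
    intro n
    induction n with
    | zero => rw [pow_zero]; exact h.one_mem
    | succ n ih => rw [pow_succ]; exact h.mul_mem ih (h.l_mem t)
  have hU1 : Module.finrank ℂ U1 ≤ i + 1 :=
    h.P2 (by omega) (h.mul_mem (hpow i) hy) hw1 U1 fun v hv => hv
  have hran : LinearMap.range Φ ≤ U.map l := by
    rintro _ ⟨⟨α, β, v⟩, rfl⟩
    have hmem : Φ (α, β, v) ∈ R 1 := by
      rw [hΦ]
      exact add_mem (Submodule.smul_mem _ _ hy)
        (add_mem (Submodule.smul_mem _ _ (h.l_mem t)) (hτ v))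
    obtain ⟨v', hv'⟩ := h.l_surj _ hmem
    refine ⟨v', ?_, hv'⟩
    show l v' * w = 0
    rw [hv', hΦ, add_mul, add_mul, smul_mul_assoc, smul_mul_assoc, hwy, hwl, hwτ]
    simp
  have hr : Module.finrank ℂ (LinearMap.range Φ) ≤ i + 1 :=
    (Submodule.finrank_mono hran).trans ((Submodule.finrank_map_le l U).trans hU)
  have hkey : ∀ α β v, Φ (α, β, v) = 0 → β = 0 ∧ v ∈ U1 := by
    intro α β v h0
    rw [hΦ] at h0
    have h1 := congrArg (l t ^ (i + 1) * ·) h0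
    simp only [mul_add, mul_smul_comm, hly, smul_zero, zero_add, mul_zero] at h1
    have h2 : β • (l t ^ (i + 1) * l t) = ((i : ℂ) + 1) • (l t ^ i * l v * y) := by
      rw [← sub_eq_zero]
      rw [← sub_eq_zero.2 (h1.trans (hrel v).symm)]
      abel
    have hβ : β = 0 := by
      have h3 := congrArg (l t ^ (3 - i) * ·) h2
      simp only [mul_smul_comm] at h3
      have e1 : l t ^ (3 - i) * (l t ^ (i + 1) * l t) = l t ^ 5 := by
        rw [← pow_succ, ← pow_add]; congr 1; omega
      have e2 : l t ^ (3 - i) * (l t ^ i * l v * y) = 0 := by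
        have : l t ^ (3 - i) = l t ^ (2 - i) * l t := by
          rw [← pow_succ]; congr 1; omega
        rw [this]
        calc _ = l t ^ (2 - i) * l v * (l t ^ (i + 1) * y) := by ring
          _ = 0 := by rw [hly, mul_zero]
      rw [e1, e2, smul_zero, smul_eq_zero] at h3
      exact h3.resolve_right h5
    refine ⟨hβ, ?_⟩
    rw [hβ, zero_smul] at h2
    have h4 := (smul_eq_zero.1 h2.symm).resolve_left (by exact_mod_cast Nat.succ_ne_zero i)
    show l v * (l t ^ i * y) = 0
    rw [← h4]; ring
  have hker : Module.finrank ℂ (LinearMap.ker Φ) ≤ Module.finrank ℂ U1 := by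
    let g : LinearMap.ker Φ →ₗ[ℂ] U1 := LinearMap.codRestrict U1
      ((LinearMap.snd ℂ ℂ (Fin 5 → ℂ)) ∘ₗ (LinearMap.snd ℂ ℂ (ℂ × (Fin 5 → ℂ))) ∘ₗ
        (LinearMap.ker Φ).subtype) (fun z => (hkey z.1.1 z.1.2.1 z.1.2.2 z.2).2)
    apply LinearMap.finrank_le_finrank_of_injective (f := g)
    rw [← LinearMap.ker_eq_bot, LinearMap.ker_eq_bot']
    rintro ⟨⟨α, β, v⟩, hz⟩ hg
    have hv : v = 0 := congrArg (fun z : U1 => (z : Fin 5 → ℂ)) hg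
    have hz' : Φ (α, β, v) = 0 := hz
    have hβ := (hkey α β v hz').1
    rw [hΦ, hβ, hv] at hz'
    simp only [zero_smul, map_zero, add_zero] at hz'
    have hα : α = 0 := (smul_eq_zero.1 hz').resolve_right fun hy0 => hw1 (by rw [hy0, mul_zero])
    subst hα hβ hv
    rfl
  have := Φ.finrank_range_add_finrank_ker
  simp at this
  omega
end
end SLP

namespace SLP
section
variable {A : Type*} [CommRing A] [Algebra ℂ A] 
variable {R : ℕ → Submodule ℂ A} {l : (Fin 5 → ℂ) →ₗ[ℂ] A} {I : A →ₗ[ℂ] ℂ}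

lemma ev_smul (t : Fin 5 → ℂ) (c : ℂ) (p : MvPolynomial (Fin 5) A) :
    ev t (c • p) = c • ev t p := by
  rw [Algebra.smul_def, Algebra.smul_def, map_mul]
  congr 1
  exact ev_C t _

/-- Specialized directional derivatives of `y`. -/
noncomputable def tau (t : Fin 5 → ℂ) (y : MvPolynomial (Fin 5) A) : (Fin 5 → ℂ) →ₗ[ℂ] A where
  toFun v := ev t (D v y)
  map_add' v v' := by rw [map_add, Derivation.add_apply, map_add]
  map_smul' c v := by rw [map_smul, Derivation.smul_apply, ev_smul]; rfl

lemma tau_apply (t : Fin 5 → ℂ) (y : MvPolynomial (Fin 5) A) (v : Fin 5 → ℂ) :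
    tau t y v = ev t (D v y) := rfl

variable (h : SD A R l I)
include h

lemma SD.descend {i : ℕ} (hi : i + 1 ≤ 3) {y : MvPolynomial (Fin 5) A} (hy : Q R 1 y)
    (h0 : ell l ^ (i + 1) * y = 0) : ell l ^ i * y = 0 := by
  by_contra hne
  have rel : ∀ j a, a + j = i + 1 → ell l ^ a * y ^ (j + 1) = 0 := by
    intro j
    induction j with
    | zero => intro a ha; rw [add_zero] at ha; rw [ha, zero_add, pow_one, h0]
    | succ j ih =>
      intro a ha
      exact h.D2 hy (by omega) (ih (a + 1) (by omega))
  obtain ⟨q1, hq1, hq1'⟩ := gen_ne hne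
  obtain ⟨q2, hq2, hq2'⟩ := gen_ne (h.ell_ne 5 le_rfl)
  obtain ⟨t, ht⟩ := exists_eval (mul_ne_zero hq1 hq2)
  rw [map_mul] at ht
  have hne1 := hq1' t (left_ne_zero_of_mul ht)
  have hne5 := hq2' t (right_ne_zero_of_mul ht)
  rw [map_mul, map_pow, ev_ell] at hne1
  rw [map_pow, ev_ell] at hne5
  have hym := ev_mem hy t
  have relt : ∀ j a, a + j = i + 1 → l t ^ a * ev t y ^ (j + 1) = 0 := by
    intro j a ha
    have := congrArg (ev t) (rel j a ha)
    rwa [map_mul, map_pow, map_pow, ev_ell, map_zero] at this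
  have hmem : ∀ a b, l t ^ a * ev t y ^ b ∈ R (a + b) := by
    intro a b
    have := ev_mem (h.Q_mul rfl (h.Q_pow h.Q_ell a) (h.Q_pow hy b)) t
    rwa [map_mul, map_pow, map_pow, ev_ell] at this
  have hrel : ∀ v, ((i : ℂ) + 1) • (l t ^ i * l v * ev t y) + l t ^ (i + 1) * tau t y v = 0 := by
    intro v
    have := congrArg (ev t) (D1 h (rel 0 (i + 1) rfl) v)
    simpa only [tau_apply, map_add, ev_smul, map_mul, map_pow, ev_ell, ev_C, map_zero, Nat.cast_zero, zero_add,
      one_smul, pow_one, pow_zero, mul_one] using this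
  have fin : ∀ a j, a + (j + 1) = i + 1 → l t ^ a * ev t y ^ (j + 1) ≠ 0 →
      (∀ v, tau t y v * (l t ^ a * ev t y ^ (j + 1)) = 0) → False := by
    intro a j haj hw hwτ
    have hm := hmem a (j + 1)
    rw [haj] at hm
    refine h.count1 hi t hym hm hw (tau t y) (fun v => ev_mem (Q_D hy v) t) ?_ ?_ hwτ hne5 ?_ hne1
      hrel
    · rw [← relt (j + 1) a haj]; ring
    · rw [← relt j (a + 1) (by omega)]; ring
    · have := relt 0 (i + 1) rfl
      rwa [zero_add, pow_one] at this
  have main : ∀ a j, a + (j + 1) = i + 1 → l t ^ a * ev t y ^ (j + 1) ≠ 0 → False := by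
    intro a
    induction a with
    | zero =>
      intro j haj hw
      refine fin 0 j haj hw fun v => ?_
      have h1 := rel (j + 1) 0 haj
      rw [pow_zero, one_mul] at h1
      have h2 := congrArg (D v) h1
      rw [Derivation.leibniz_pow, map_zero, Nat.add_sub_cancel, smul_eq_mul,
        ← Nat.cast_smul_eq_nsmul ℂ, smul_eq_zero] at h2
      have h3 := congrArg (ev t) (h2.resolve_left (by exact_mod_cast Nat.succ_ne_zero (j + 1)))
      rw [map_mul, map_pow, map_zero] at h3
      rw [pow_zero, one_mul, tau_apply, mul_comm, h3]
    | succ a ih =>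
      intro j haj hw
      by_cases hz : l t ^ a * ev t y ^ (j + 1 + 1) = 0
      · refine fin (a + 1) j haj hw fun v => ?_
        have := congrArg (ev t) (D1 h (rel (j + 1) (a + 1) haj) v)
        simp only [map_add, ev_smul, map_mul, map_pow, ev_ell, ev_C, map_zero] at this
        rw [mul_right_comm, hz, zero_mul, smul_zero, zero_add, smul_eq_zero] at this
        have h3 := this.resolve_left (by exact_mod_cast Nat.succ_ne_zero (j + 1))
        rw [tau_apply, mul_comm, h3]
      · exact ih (j + 1) (by omega) hz
  exact main i 0 (by omega) (by rwa [zero_add, pow_one])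

lemma SD.inj1 : ∃ q : P, q ≠ 0 ∧ ∀ t, eval t q ≠ 0 → ∀ z ∈ R 1, l t ^ 3 * z = 0 → z = 0 := by
  obtain ⟨q, hq, hq'⟩ := h.mat (k := 1) (s := 3) rfl rfl (ell l ^ 3) (h.Q_pow h.Q_ell 3) (by
    intro y hy h0
    have h1 := h.descend (i := 2) (by omega) hy h0
    have h2 := h.descend (i := 1) (by omega) hy h1
    have h3 := h.descend (i := 0) (by omega) hy h2
    rwa [pow_zero, one_mul] at h3)
  refine ⟨q, hq, fun t ht z hz h0 => hq' t ht z hz ?_⟩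
  rwa [map_pow, ev_ell]

/-- The dimension count for the map `R_2 → R_3`. -/
lemma SD.count2 (t : Fin 5 → ℂ) {y : A} (hy : y ∈ R 2) (hy0 : y ≠ 0)
    (τ : (Fin 5 → ℂ) →ₗ[ℂ] A) (hτ : ∀ v, τ v ∈ R 2) (hly : l t * y = 0)
    (hyτ : ∀ v, y * τ v = 0) (hrel : ∀ v, l v * y + l t * τ v = 0)
    (h3 : ∀ z ∈ R 1, l t ^ 3 * z = 0 → z = 0) : False := by
  have := h.fin 2
  let U : Submodule ℂ (Fin 5 → ℂ) := LinearMap.ker ((LinearMap.mulRight ℂ y) ∘ₗ l)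
  have hU : Module.finrank ℂ U ≤ 2 := h.P2 (by omega) hy hy0 U fun v hv => hv
  let Ψ : ((Fin 5 → ℂ) × (Fin 5 → ℂ)) →ₗ[ℂ] A :=
    ((LinearMap.mulLeft ℂ (l t)) ∘ₗ l).coprod (-τ)
  have hΨ : ∀ z v, Ψ (z, v) = l t * l z + -τ v := fun z v => rfl
  let f : R 2 →ₗ[ℂ] A := (LinearMap.mulLeft ℂ y) ∘ₗ (R 2).subtype
  have hf : ∀ r, f r = y * r := fun r => rfl
  have hran : LinearMap.range Ψ ≤ (LinearMap.ker f).map (R 2).subtype := by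
    rintro _ ⟨⟨z, v⟩, rfl⟩
    have hm : Ψ (z, v) ∈ R 2 := by
      rw [hΨ]
      exact add_mem (h.mul_mem (i := 1) (j := 1) (h.l_mem t) (h.l_mem z)) (neg_mem (hτ v))
    refine ⟨⟨_, hm⟩, ?_, rfl⟩
    show y * Ψ (z, v) = 0
    rw [hΨ, mul_add, mul_neg, hyτ]
    have : y * (l t * l z) = 0 := by rw [← zero_mul (l z), ← hly]; ring
    rw [this]; simp
  have hr : Module.finrank ℂ (LinearMap.range Ψ) ≤ Module.finrank ℂ (LinearMap.ker f) :=
    (Submodule.finrank_mono hran).trans (Submodule.finrank_map_le _ _)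
  have hkey : ∀ z v, Ψ (z, v) = 0 → z = 0 ∧ v ∈ U := by
    intro z v h0
    rw [hΨ] at h0
    have e1 : l t ^ 3 * l z = 0 := by
      have : l t ^ 3 * l z = l t ^ 2 * (l t * l z + -τ v) + l t * (l v * y + l t * τ v)
          - l v * (l t * y) := by ring
      rw [this, h0, hrel, hly]; simp
    have e2 := h3 _ (h.l_mem z) e1
    have e3 : z = 0 := h.l_inj (by rw [e2, map_zero])
    refine ⟨e3, ?_⟩
    rw [e2, mul_zero, zero_add, neg_eq_zero] at h0
    have := hrel v
    rw [h0, mul_zero, add_zero] at this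
    exact this
  have hker : Module.finrank ℂ (LinearMap.ker Ψ) ≤ Module.finrank ℂ U := by
    let g : LinearMap.ker Ψ →ₗ[ℂ] U := LinearMap.codRestrict U
      ((LinearMap.snd ℂ (Fin 5 → ℂ) (Fin 5 → ℂ)) ∘ₗ
        (LinearMap.ker Ψ).subtype) (fun z => (hkey z.1.1 z.1.2 z.2).2)
    apply LinearMap.finrank_le_finrank_of_injective (f := g)
    rw [← LinearMap.ker_eq_bot, LinearMap.ker_eq_bot']
    rintro ⟨⟨z, v⟩, hz⟩ hg
    have hv : v = 0 := congrArg (fun z : U => (z : Fin 5 → ℂ)) hg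
    have hz0 := (hkey z v hz).1
    subst hv hz0
    rfl
  let Θ : (Fin 5 → ℂ) →ₗ[ℂ] Module.Dual ℂ (LinearMap.range f) :=
    (LinearMap.lcomp ℂ ℂ (LinearMap.range f).subtype) ∘ₗ (LinearMap.llcomp ℂ A A ℂ I) ∘ₗ
      (LinearMap.mul ℂ A) ∘ₗ l
  have hΘ : ∀ v u, Θ v u = I (l v * u) := fun v u => rfl
  have hker2 : LinearMap.ker Θ ≤ U := by
    intro v hv
    show l v * y = 0
    refine h.pair (k := 3) (m := 2) rfl _ (h.mul_mem (i := 1) (h.l_mem v) hy) fun r hr => ?_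
    have hm : l v * y * r ∈ R 5 := h.mul_mem (i := 3) (h.mul_mem (i := 1) (h.l_mem v) hy) hr
    apply h.inj5 _ hm
    have := congrArg (fun φ => φ ⟨f ⟨r, hr⟩, ⟨_, rfl⟩⟩) (LinearMap.mem_ker.1 hv)
    simp only [hΘ, hf, LinearMap.zero_apply] at this
    rwa [mul_assoc]
  have d1 := Ψ.finrank_range_add_finrank_ker
  have d2 := f.finrank_range_add_finrank_ker
  have d3 := Θ.finrank_range_add_finrank_ker
  have d4 := Submodule.finrank_mono hker2
  have d5 := Submodule.finrank_le (LinearMap.range Θ)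
  rw [Subspace.dual_finrank_eq] at d5
  have d6 := h.dim2
  rw [Module.finrank_prod, Module.finrank_fin_fun] at d1
  rw [Module.finrank_fin_fun] at d3
  omega

lemma SD.inj2 : ∃ q : P, q ≠ 0 ∧ ∀ t, eval t q ≠ 0 → ∀ z ∈ R 2, l t * z = 0 → z = 0 := by
  obtain ⟨q, hq, hq'⟩ := h.mat (k := 2) (s := 1) rfl rfl (ell l) h.Q_ell (by
    intro y hy h0
    by_contra hne
    have rel : ∀ v, C (l v) * y + ell l * D v y = 0 := by
      intro v
      have := congrArg (D v) h0
      rw [Derivation.leibniz, D_ell, map_zero, smul_eq_mul, smul_eq_mul] at this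
      rw [← this]; ring
    have hyy : y * y = 0 := by
      refine h.QP1 (j := 4) le_rfl (h.Q_mul rfl hy hy) fun v => ?_
      have : C (l v) * (y * y) = (C (l v) * y + ell l * D v y) * y - D v y * (ell l * y) := by ring
      rw [this, rel, h0]; simp
    have hyD : ∀ v, y * D v y = 0 := by
      intro v
      have := congrArg (D v) hyy
      rw [Derivation.leibniz, map_zero, smul_eq_mul, ← two_smul ℂ, smul_eq_zero] at this
      exact this.resolve_left two_ne_zero
    obtain ⟨q1, hq1, hq1'⟩ := gen_ne hne
    obtain ⟨q2, hq2, hq2'⟩ := h.inj1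
    obtain ⟨t, ht⟩ := exists_eval (mul_ne_zero hq1 hq2)
    rw [map_mul] at ht
    refine h.count2 t (ev_mem hy t) (hq1' t (left_ne_zero_of_mul ht)) (tau t y)
      (fun v => ev_mem (Q_D hy v) t) ?_ (fun v => ?_) (fun v => ?_)
      (hq2' t (right_ne_zero_of_mul ht))
    · have := congrArg (ev t) h0
      rwa [map_mul, ev_ell, map_zero] at this
    · have := congrArg (ev t) (hyD v)
      rwa [map_mul, map_zero] at this
    · have := congrArg (ev t) (rel v)
      rwa [map_add, map_mul, map_mul, ev_C, ev_ell, map_zero] at this)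
  refine ⟨q, hq, fun t ht z hz h0 => hq' t ht z hz ?_⟩
  rwa [ev_ell]

lemma SD.finrank_le {k m : ℕ} (hkm : m + k = 5) :
    Module.finrank ℂ (R m) ≤ Module.finrank ℂ (R k) := by
  have := h.fin k
  have := h.fin m
  let Θ : R m →ₗ[ℂ] Module.Dual ℂ (R k) :=
    (LinearMap.lcomp ℂ ℂ (R k).subtype) ∘ₗ (LinearMap.llcomp ℂ A A ℂ I) ∘ₗ
      (LinearMap.mul ℂ A) ∘ₗ (R m).subtype
  have hΘ : ∀ v u, Θ v u = I ((v : A) * u) := fun v u => rfl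
  rw [← Subspace.dual_finrank_eq (K := ℂ) (V := R k)]
  apply LinearMap.finrank_le_finrank_of_injective (f := Θ)
  rw [← LinearMap.ker_eq_bot, LinearMap.ker_eq_bot']
  intro v hv
  apply Subtype.ext
  refine h.pair hkm _ v.2 fun z hz => ?_
  apply h.inj5
  · rw [← hkm]; exact h.mul_mem v.2 hz
  · have := congrArg (fun φ => φ ⟨z, hz⟩) hv
    simpa only [hΘ, LinearMap.zero_apply] using this

theorem SD.main : ∃ t, ∀ k ≤ 2, (∀ z ∈ R k, l t ^ (5 - 2 * k) * z = 0 → z = 0) ∧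
    ∀ c ∈ R (5 - k), ∃ z ∈ R k, l t ^ (5 - 2 * k) * z = c := by
  obtain ⟨q0, hq0, hq0'⟩ := gen_ne (h.ell_ne 5 le_rfl)
  obtain ⟨q1, hq1, hq1'⟩ := h.inj1
  obtain ⟨q2, hq2, hq2'⟩ := h.inj2
  obtain ⟨t, ht⟩ := exists_eval (mul_ne_zero (mul_ne_zero hq0 hq1) hq2)
  rw [map_mul, map_mul] at ht
  have hpow : ∀ n, l t ^ n ∈ R n := by
    intro n
    induction n with
    | zero => rw [pow_zero]; exact h.one_mem
    | succ n ih => rw [pow_succ]; exact h.mul_mem ih (h.l_mem t)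
  have hinj : ∀ k ≤ 2, (∀ z ∈ R k, l t ^ (5 - 2 * k) * z = 0 → z = 0) := by
    intro k hk
    have hk' : k = 0 ∨ k = 1 ∨ k = 2 := by omega
    rcases hk' with rfl | rfl | rfl
    · intro z hz h0
      obtain ⟨c, rfl⟩ := h.R0 z hz
      have h5 := hq0' t (left_ne_zero_of_mul (left_ne_zero_of_mul ht))
      rw [map_pow, ev_ell] at h5
      rw [mul_comm, ← Algebra.smul_def, smul_eq_zero] at h0
      rw [h0.resolve_right h5, map_zero]
    · exact hq1' t (right_ne_zero_of_mul (left_ne_zero_of_mul ht))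
    · have := hq2' t (right_ne_zero_of_mul ht)
      simpa using this
  refine ⟨t, fun k hk => ⟨hinj k hk, ?_⟩⟩
  have := h.fin k
  have := h.fin (5 - k)
  let f : R k →ₗ[ℂ] R (5 - k) := LinearMap.codRestrict _
    ((LinearMap.mulLeft ℂ (l t ^ (5 - 2 * k))) ∘ₗ (R k).subtype) (fun z => by
      have := h.mul_mem (hpow (5 - 2 * k)) z.2
      rwa [show 5 - 2 * k + k = 5 - k by omega] at this)
  have hf : Function.Injective f := by
    rw [← LinearMap.ker_eq_bot, LinearMap.ker_eq_bot']
    intro z hz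
    apply Subtype.ext
    exact hinj k hk z z.2 (congrArg (fun z : R (5 - k) => (z : A)) hz)
  have hd : Module.finrank ℂ (R k) = Module.finrank ℂ (R (5 - k)) :=
    le_antisymm (LinearMap.finrank_le_finrank_of_injective hf) (h.finrank_le (by omega))
  have hs := (LinearMap.injective_iff_surjective_of_finrank_eq_finrank hd).1 hf
  intro c hc
  obtain ⟨z, hz⟩ := hs ⟨c, hc⟩
  exact ⟨z, z.2, congrArg (fun z : R (5 - k) => (z : A)) hz⟩
end

end SLP

namespace SLP

theorem final :
    ∀ F ∈ homogeneousSubmodule (Fin 5) ℂ 3, SmoothForm F →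
      ∃ ℓ ∈ homogeneousSubmodule (Fin 5) ℂ 1, ∀ k ≤ 2,
        (∀ b ∈ homogeneousSubmodule (Fin 5) ℂ k,
          ℓ ^ (5 - 2 * k) * b ∈ jacobianIdeal F → b ∈ jacobianIdeal F) ∧
        (∀ c ∈ homogeneousSubmodule (Fin 5) ℂ (5 - k),
          ∃ b ∈ homogeneousSubmodule (Fin 5) ℂ k,
            c - ℓ ^ (5 - 2 * k) * b ∈ jacobianIdeal F) := by
  intro F hF hsm
  let W : Submodule ℂ P := Submodule.span ℂ (Set.range fun i => pderiv i F)
  have hJ : jacobianIdeal F = Ideal.span (W : Set P) := by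
    unfold jacobianIdeal
    apply le_antisymm
    · exact Ideal.span_mono Submodule.subset_span
    · rw [Ideal.span_le]
      have : W ≤ (Ideal.span (Set.range fun i => pderiv i F)).restrictScalars ℂ :=
        Submodule.span_le.2 Ideal.subset_span
      exact this
  have hW2 : W ≤ Sd 2 := by
    refine Submodule.span_le.2 ?_
    rintro _ ⟨i, rfl⟩
    exact IsHomogeneous.pderiv hF
  have hfin : Module.Finite ℂ W := Module.Finite.span_of_finite ℂ (Set.finite_range _)
  have hr : Module.finrank ℂ W ≤ 5 := by
    exact (finrank_range_le_card (R := ℂ) (fun i => pderiv i F)).trans (by simp)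
  have hZ : ∀ x : Fin 5 → ℂ, (∀ w ∈ W, eval x w = 0) → x = 0 := fun x hx =>
    hsm x fun i => hx _ (Submodule.subset_span ⟨i, rfl⟩)
  obtain ⟨I, hI⟩ := exists_SD hW2 hfin hr hZ
  obtain ⟨t, ht⟩ := hI.main
  rw [hJ]
  refine ⟨L t, L_mem t, fun k hk => ⟨fun b hb h0 => ?_, fun c hc => ?_⟩⟩
  · rw [← Ideal.Quotient.eq_zero_iff_mem] at h0 ⊢
    rw [map_mul, map_pow] at h0
    exact (ht k hk).1 _ (mem_Rk.2 ⟨b, hb, rfl⟩) h0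
  · obtain ⟨z, hz, hzc⟩ := (ht k hk).2 _ (mem_Rk.2 ⟨c, hc, rfl⟩)
    obtain ⟨b, hb, rfl⟩ := mem_Rk.1 hz
    refine ⟨b, hb, ?_⟩
    rw [← Ideal.Quotient.eq_zero_iff_mem, map_sub, map_mul, map_pow, sub_eq_zero]
    exact hzc.symm

end SLP

/-- Strong Lefschetz property for smooth cubic threefolds: there is a linear form `ℓ` such
that for `k = 0, 1, 2` multiplication by `ℓ^{5-2k}` induces an isomorphism
`M(F)_k → M(F)_{5-k}` (stated elementwise: it is injective and surjective modulo `J_F`). -/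
theorem strong_lefschetz_cubic_threefold :
    ∀ F ∈ homogeneousSubmodule (Fin 5) ℂ 3, SmoothForm F →
      ∃ ℓ ∈ homogeneousSubmodule (Fin 5) ℂ 1, ∀ k ≤ 2,
        (∀ b ∈ homogeneousSubmodule (Fin 5) ℂ k,
          ℓ ^ (5 - 2 * k) * b ∈ jacobianIdeal F → b ∈ jacobianIdeal F) ∧
        (∀ c ∈ homogeneousSubmodule (Fin 5) ℂ (5 - k),
          ∃ b ∈ homogeneousSubmodule (Fin 5) ℂ k,
            c - ℓ ^ (5 - 2 * k) * b ∈ jacobianIdeal F) := by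
  exact SLP.final
end

section
/- (Macaulay duality for smooth cubic threefolds.) Let F ∈ ℂ[x₀,…,x₄] be a smooth cubic form. Then dim S_5/J_{F,5} = 1, and the bilinear pairing (S_2/J_{F,2}) × (S_3/J_{F,3}) → S_5/J_{F,5} induced by polynomial multiplication is nondegenerate: if a ∈ S_2 satisfies aB ∈ J_{F,5} for all B ∈ S_3 then a ∈ J_{F,2}, and if b ∈ S_3 satisfies ab ∈ J_{F,5} for all a ∈ S_2 then b ∈ J_{F,3}. -/
open MvPolynomial

/-- The degree-`k` graded piece `M(F)_k = S_k/J_{F,k}` of the Milnor algebra, realized as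
the image of `S_k` in `S/J_F`. -/
noncomputable def milnorPiece {N : ℕ} (F : MvPolynomial (Fin N) ℂ) (k : ℕ) :
    Submodule ℂ
      (MvPolynomial (Fin N) ℂ ⧸ Submodule.restrictScalars ℂ (jacobianIdeal F)) :=
  Submodule.map (Submodule.mkQ _) (homogeneousSubmodule (Fin N) ℂ k)


open scoped TensorProduct

namespace MacDual

/-- The polynomial ring in five variables. -/
abbrev S := MvPolynomial (Fin 5) ℂ

lemma pderiv_comm' (i j : Fin 5) (f : S) :
    pderiv i (pderiv j f) = pderiv j (pderiv i f) := by
  have h : ⁅(pderiv i : Derivation ℂ S S), (pderiv j : Derivation ℂ S S)⁆ = 0 := by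
    apply MvPolynomial.derivation_ext
    intro k
    simp only [Derivation.commutator_apply, Derivation.zero_apply, pderiv_X]
    simp only [Pi.single_apply]
    split_ifs <;> simp
  have h2 := congrArg (fun D => D f) h
  simp only [Derivation.commutator_apply, Derivation.zero_apply] at h2
  exact sub_eq_zero.mp h2

/-- Cramer's rule as ideal membership. -/
lemma cramer_mem {R : Type*} [CommRing R] (M : Matrix (Fin 5) (Fin 5) R) (x : Fin 5 → R)
    (I : Ideal R) (h : ∀ i, (∑ j, M i j * x j) ∈ I) (k : Fin 5) : M.det * x k ∈ I := by
  have h1 : (M.adjugate * M).mulVec x k = M.det * x k := by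
    rw [Matrix.adjugate_mul, Matrix.smul_mulVec, Matrix.one_mulVec]; simp
  rw [← h1, ← Matrix.mulVec_mulVec]
  have h2 : M.adjugate.mulVec (M.mulVec x) k = ∑ i, M.adjugate k i * ∑ j, M i j * x j := rfl
  rw [h2]
  exact Ideal.sum_mem I fun i _ => Ideal.mul_mem_left I (M.adjugate k i) (h i)

/-- Ideal generated by the pure powers with index in `s`. -/
noncomputable def powIdeal (n : Fin 5 → ℕ) (s : Set (Fin 5)) : Ideal S :=
  Ideal.span ((fun i => (X i : S) ^ (n i + 1)) '' s)

lemma mem_powIdeal (n : Fin 5 → ℕ) (s : Set (Fin 5)) (p : S) :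
    p ∈ powIdeal n s ↔ ∀ m ∈ p.support, ∃ i ∈ s, n i + 1 ≤ m i := by
  have := @mem_ideal_span_monomial_image (Fin 5) ℂ _ p
    ((fun i => Finsupp.single i (n i + 1)) '' s)
  rw [Set.image_image] at this
  simp only [← X_pow_eq_monomial] at this
  rw [powIdeal, this]
  simp only [Set.exists_mem_image, Finsupp.single_le_iff]

lemma powIdeal_cancel (n : Fin 5 → ℕ) (r : Fin 5) (p : S)
    (h : p * X r ∈ powIdeal n {i | i ≠ r}) : p ∈ powIdeal n {i | i ≠ r} := by
  rw [mem_powIdeal] at h ⊢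
  intro m hm
  obtain ⟨i, hi, hle⟩ := h (m + Finsupp.single r 1) (by
    rw [mem_support_iff, coeff_mul_X]; exact mem_support_iff.mp hm)
  refine ⟨i, hi, ?_⟩
  simp only [Set.mem_ofPred_eq] at hi
  simpa [Finsupp.single_apply, hi.symm] using hle

lemma prod_notMem (n : Fin 5 → ℕ) : (∏ i, (X i : S) ^ n i) ∉ powIdeal n Set.univ := by
  rw [mem_powIdeal]
  have h : (∏ i, (X i : S) ^ n i) = monomial (Finsupp.equivFunOnFinite.symm n) 1 := by
    rw [monomial_eq, Finsupp.prod_fintype] <;> simp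
  rw [h]
  intro hh
  obtain ⟨i, _, hi⟩ := hh (Finsupp.equivFunOnFinite.symm n) (by simp)
  simp at hi

lemma row_mem (n : Fin 5 → ℕ) (M : Matrix (Fin 5) (Fin 5) S) (r : Fin 5)
    (hM : ∀ i, i ≠ r → ∑ j, M i j * X j = X i ^ (n i + 1))
    (hr : ∑ j, M r j * X j = 0) : M.det ∈ powIdeal n Set.univ := by
  have h1 : M.det ∈ powIdeal n {i | i ≠ r} := by
    apply powIdeal_cancel
    apply cramer_mem M (fun j => X j)
    intro i
    by_cases hi : i = r
    · subst hi; rw [hr]; exact zero_mem _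
    · rw [hM i hi]; exact Ideal.subset_span ⟨i, hi, rfl⟩
  exact Ideal.span_mono (Set.image_mono (Set.subset_univ _)) h1

lemma det_sub_mem (n : Fin 5 → ℕ) (M : Matrix (Fin 5) (Fin 5) S)
    (hM : ∀ i, ∑ j, M i j * X j = X i ^ (n i + 1)) :
    M.det - ∏ i, (X i : S) ^ n i ∈ powIdeal n Set.univ := by
  classical
  set D : Matrix (Fin 5) (Fin 5) S := Matrix.diagonal fun i => X i ^ n i with hD
  have hDx : ∀ i, ∑ j, D i j * X j = X i ^ (n i + 1) := by
    intro i
    simp [hD, Matrix.diagonal_apply, pow_succ]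
  have key : ∀ s : Finset (Fin 5),
      Matrix.det (fun i => if i ∈ s then M i else D i) - D.det ∈ powIdeal n Set.univ := by
    intro s
    induction s using Finset.induction_on with
    | empty => simp
    | insert r s hrs ih =>
      set N : Matrix (Fin 5) (Fin 5) S := fun i => if i ∈ s then M i else D i with hN
      have hNx : ∀ i, ∑ j, N i j * X j = X i ^ (n i + 1) := by
        intro i
        by_cases h : i ∈ s
        · simp only [hN, h, if_true]; exact hM i
        · simp only [hN, h, if_false]; exact hDx i
      have e1 : (fun i => if i ∈ insert r s then M i else D i : Matrix (Fin 5) (Fin 5) S)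
          = N.updateRow r (N r + (M r - N r)) := by
        funext i
        by_cases h : i = r
        · subst h; simp
        · rw [Matrix.updateRow_ne h]; simp [hN, h]
      rw [e1, Matrix.det_updateRow_add, Matrix.updateRow_eq_self, add_sub_right_comm]
      refine add_mem ih (row_mem n _ r ?_ ?_)
      · intro i hi
        rw [Matrix.updateRow_ne hi]; exact hNx i
      · rw [Matrix.updateRow_self]
        simp only [Pi.sub_apply, sub_mul, Finset.sum_sub_distrib, hM, hNx, sub_self]
  have := key Finset.univ
  simpa [hD] using this

lemma det_notMem (f : Fin 5 → S) (A : Matrix (Fin 5) (Fin 5) S)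
    (hA : ∀ i, ∑ j, A i j * X j = f i)
    (hrad : ∀ i, ∃ k, (X i : S) ^ k ∈ Ideal.span (Set.range f)) :
    A.det ∉ Ideal.span (Set.range f) := by
  intro hmem
  choose n hn using hrad
  have hC : ∀ i, ∃ c : Fin 5 → S, ∑ j, c j * f j = X i ^ (n i + 1) := by
    intro i
    have : (X i : S) ^ (n i + 1) ∈ Ideal.span (Set.range f) := by
      rw [pow_succ]; exact Ideal.mul_mem_right _ _ (hn i)
    exact Ideal.mem_span_range_iff_exists_fun.mp this
  choose c hc using hC
  set C' : Matrix (Fin 5) (Fin 5) S := Matrix.of c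
  have h1 := det_sub_mem n (C' * A) (by
    intro i
    have e : ∀ M : Matrix (Fin 5) (Fin 5) S, ∑ j, M i j * X j = M.mulVec (fun j => X j) i :=
      fun _ => rfl
    have e2 : A.mulVec (fun j => X j) = f := funext hA
    rw [e, ← Matrix.mulVec_mulVec, e2]
    exact hc i)
  have h2 : C'.det * A.det ∈ powIdeal n Set.univ := by
    have h3 : ∀ k, C'.det * f k ∈ powIdeal n Set.univ := by
      apply cramer_mem
      intro i
      have : ∑ j, C' i j * f j = X i ^ (n i + 1) := hc i
      rw [this]
      exact Ideal.subset_span ⟨i, trivial, rfl⟩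
    obtain ⟨b, hb⟩ := Ideal.mem_span_range_iff_exists_fun.mp hmem
    rw [← hb, Finset.mul_sum]
    refine Ideal.sum_mem _ fun k _ => ?_
    rw [mul_left_comm]
    exact Ideal.mul_mem_left _ _ (h3 k)
  rw [Matrix.det_mul] at h1
  exact prod_notMem n (by simpa using sub_mem h2 h1)

/-- Span of pure tensors of total degree `n`. -/
noncomputable def W (n : ℕ) : Submodule ℂ (S ⊗[ℂ] S) :=
  Submodule.span ℂ {t | ∃ i j, i + j = n ∧ ∃ u v : S, u.IsHomogeneous i ∧ v.IsHomogeneous j ∧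
    t = u ⊗ₜ v}

lemma W_mul {a b : ℕ} {s t : S ⊗[ℂ] S} (hs : s ∈ W a) (ht : t ∈ W b) : s * t ∈ W (a + b) := by
  have h := Submodule.mul_mem_mul hs ht
  rw [W, W, Submodule.span_mul_span] at h
  refine Submodule.span_mono ?_ h
  rintro _ ⟨_, ⟨i, j, hij, u, v, hu, hv, rfl⟩, _, ⟨i', j', hij', u', v', hu', hv', rfl⟩, rfl⟩
  refine ⟨i + i', j + j', by omega, u * u', v * v', hu.mul hu', hv.mul hv', ?_⟩
  simp

lemma W_one : (1 : S ⊗[ℂ] S) ∈ W 0 :=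
  Submodule.subset_span ⟨0, 0, rfl, 1, 1, isHomogeneous_one _ _, isHomogeneous_one _ _, rfl⟩

lemma W_prod (s : Finset (Fin 5)) (g : Fin 5 → S ⊗[ℂ] S) (h : ∀ i, g i ∈ W 1) :
    ∏ i ∈ s, g i ∈ W s.card := by
  classical
  induction s using Finset.induction_on with
  | empty => simpa using W_one
  | insert r s hr ih =>
    rw [Finset.prod_insert hr, Finset.card_insert_of_notMem hr, add_comm]
    exact W_mul (h r) ih

lemma W_det (M : Matrix (Fin 5) (Fin 5) (S ⊗[ℂ] S)) (h : ∀ i j, M i j ∈ W 1) :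
    M.det ∈ W 5 := by
  rw [Matrix.det_apply]
  refine Submodule.sum_mem _ fun σ _ => ?_
  have h1 : ∏ i, M (σ i) i ∈ W 5 := by
    simpa using W_prod Finset.univ (fun i => M (σ i) i) fun i => h _ _
  rcases Int.units_eq_one_or (Equiv.Perm.sign σ) with e | e <;> rw [e]
  · simpa using h1
  · simpa using h1

/-- Slice a tensor by a functional on the left factor. -/
noncomputable def slice (φ : S →ₗ[ℂ] ℂ) : S ⊗[ℂ] S →ₗ[ℂ] S :=
  (TensorProduct.lid ℂ S).toLinearMap ∘ₗ LinearMap.rTensor S φ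

@[simp] lemma slice_tmul (φ : S →ₗ[ℂ] ℂ) (u v : S) : slice φ (u ⊗ₜ v) = φ u • v := by
  simp [slice]

lemma slice_right (φ : S →ₗ[ℂ] ℂ) (g : S) (t : S ⊗[ℂ] S) :
    slice φ (((1 : S) ⊗ₜ g) * t) = g * slice φ t := by
  induction t using TensorProduct.induction_on with
  | zero => simp
  | tmul u v => simp
  | add a b ha hb => rw [mul_add, map_add, ha, hb, map_add, mul_add]

lemma slice_left (φ : S →ₗ[ℂ] ℂ) (J : Ideal S) (hφ : ∀ p ∈ J, φ p = 0) (f : S) (hf : f ∈ J)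
    (t : S ⊗[ℂ] S) : slice φ ((f ⊗ₜ (1 : S)) * t) = 0 := by
  induction t using TensorProduct.induction_on with
  | zero => simp
  | tmul u v => simp [hφ _ (Ideal.mul_mem_right u J hf)]
  | add a b ha hb => rw [mul_add, map_add, ha, hb, add_zero]

/-- The ideal in the tensor square generated by both copies of the `f i`. -/
noncomputable def K (f : Fin 5 → S) : Ideal (S ⊗[ℂ] S) :=
  Ideal.span (Set.range (fun i => f i ⊗ₜ[ℂ] (1 : S)) ∪ Set.range (fun i => (1 : S) ⊗ₜ[ℂ] f i))

lemma slice_K (φ : S →ₗ[ℂ] ℂ) (f : Fin 5 → S) (hφ : ∀ p ∈ Ideal.span (Set.range f), φ p = 0)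
    (t : S ⊗[ℂ] S) (ht : t ∈ K f) : slice φ t ∈ Ideal.span (Set.range f) := by
  suffices h : ∀ c : S ⊗[ℂ] S, slice φ (t * c) ∈ Ideal.span (Set.range f) by
    simpa using h 1
  unfold K at ht
  induction ht using Submodule.span_induction with
  | zero => simp
  | add a b _ _ ha hb => intro c; rw [add_mul, map_add]; exact add_mem (ha c) (hb c)
  | smul d a _ ha =>
    intro c
    have : d • a * c = a * (d * c) := by rw [smul_eq_mul]; ring
    rw [this]; exact ha _
  | mem a ha =>
    intro c
    rcases ha with ⟨i, rfl⟩ | ⟨i, rfl⟩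
    · simp only
      rw [slice_left φ _ hφ (f i) (Ideal.subset_span ⟨i, rfl⟩)]
      exact zero_mem _
    · simp only
      rw [slice_right]
      exact Ideal.mul_mem_right _ _ (Ideal.subset_span ⟨i, rfl⟩)

lemma swap_mem (f : Fin 5 → S) (M : Matrix (Fin 5) (Fin 5) (S ⊗[ℂ] S))
    (hM : ∀ i, ∑ j, M i j * ((X j : S) ⊗ₜ[ℂ] (1 : S) - (1 : S) ⊗ₜ[ℂ] (X j : S)) =
      f i ⊗ₜ[ℂ] (1 : S) - (1 : S) ⊗ₜ[ℂ] f i) (g : S) :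
    (g ⊗ₜ[ℂ] (1 : S) - (1 : S) ⊗ₜ[ℂ] g) * M.det ∈ K f := by
  have hX : ∀ k, ((X k : S) ⊗ₜ[ℂ] (1 : S) - (1 : S) ⊗ₜ[ℂ] (X k : S)) * M.det ∈ K f := by
    intro k
    rw [mul_comm]
    refine cramer_mem M (fun k => (X k : S) ⊗ₜ[ℂ] (1 : S) - (1 : S) ⊗ₜ[ℂ] (X k : S)) (K f) ?_ k
    intro i
    rw [hM i]
    exact sub_mem (Ideal.subset_span (Or.inl ⟨i, rfl⟩)) (Ideal.subset_span (Or.inr ⟨i, rfl⟩))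
  induction g using MvPolynomial.induction_on with
  | C a =>
    have : (C a : S) = a • 1 := by rw [smul_eq_C_mul, mul_one]
    rw [this, TensorProduct.smul_tmul, sub_self, zero_mul]
    exact zero_mem _
  | add p q hp hq =>
    have := add_mem hp hq
    rw [← add_mul] at this
    convert this using 2
    rw [TensorProduct.add_tmul, TensorProduct.tmul_add]; ring
  | mul_X p k hp =>
    have := add_mem (Ideal.mul_mem_left _ ((X k : S) ⊗ₜ[ℂ] (1 : S)) hp)
      (Ideal.mul_mem_left _ ((1 : S) ⊗ₜ[ℂ] p) (hX k))
    convert this using 1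
    have e1 : (p * X k) ⊗ₜ[ℂ] (1 : S) = (p ⊗ₜ[ℂ] (1 : S)) * ((X k : S) ⊗ₜ[ℂ] (1 : S)) := by simp
    have e2 : (1 : S) ⊗ₜ[ℂ] (p * X k) = ((1 : S) ⊗ₜ[ℂ] p) * ((1 : S) ⊗ₜ[ℂ] (X k : S)) := by simp
    rw [e1, e2]; ring

/-- Evaluate the right factor at zero. -/
noncomputable def ev0 : S ⊗[ℂ] S →ₐ[ℂ] S :=
  Algebra.TensorProduct.lift (AlgHom.id ℂ S) (aeval (fun _ => (0 : S))) (fun _ _ => Commute.all _ _)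

lemma ev0_tmul (u v : S) : ev0 (u ⊗ₜ[ℂ] v) = u * C (constantCoeff v) := by
  rw [ev0, Algebra.TensorProduct.lift_tmul, AlgHom.id_apply]
  congr 1
  rw [← Pi.zero_def, aeval_zero]
  rfl

lemma constCoeff_zero {v : S} {j : ℕ} (hv : v.IsHomogeneous j) (hj : 0 < j) :
    constantCoeff v = 0 := by
  rw [constantCoeff_eq]
  exact hv.coeff_eq_zero (by simp; omega)

lemma eq_C_of_deg_zero {p : S} (h : p.IsHomogeneous 0) : ∃ c, p = C c :=
  ⟨_, totalDegree_eq_zero_iff_eq_C.mp ((totalDegree_zero_iff_isHomogeneous _).mpr h)⟩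

lemma slice_W (φ : S →ₗ[ℂ] ℂ) (h5 : ∀ d, d ≠ 5 → ∀ p : S, p.IsHomogeneous d → φ p = 0)
    (t : S ⊗[ℂ] S) (ht : t ∈ W 5) : slice φ t = C (φ (ev0 t)) := by
  unfold W at ht
  induction ht using Submodule.span_induction with
  | zero => simp
  | add a b _ _ ha hb => simp only [map_add, ha, hb]
  | smul c a _ ha => rw [map_smul, ha, map_smul, map_smul, smul_eq_C_mul, smul_eq_mul, C_mul]
  | mem a ha =>
    obtain ⟨i, j, hij, u, v, hu, hv, rfl⟩ := ha
    rcases Nat.eq_zero_or_pos j with rfl | hj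
    · obtain ⟨c, rfl⟩ := eq_C_of_deg_zero hv
      have : (u * C c : S) = c • u := by rw [smul_eq_C_mul, mul_comm]
      rw [slice_tmul, ev0_tmul, constantCoeff_C, this, map_smul, smul_eq_C_mul, smul_eq_mul, C_mul,
        mul_comm]
    · rw [slice_tmul, h5 i (by omega) u hu, ev0_tmul, constCoeff_zero hv hj]
      simp

lemma core (f : Fin 5 → S) (A : Matrix (Fin 5) (Fin 5) S) (hAh : ∀ i j, (A i j).IsHomogeneous 1)
    (hM : ∀ i, ∑ j, (A i j ⊗ₜ[ℂ] (1 : S) + (1 : S) ⊗ₜ[ℂ] A i j) *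
      ((X j : S) ⊗ₜ[ℂ] (1 : S) - (1 : S) ⊗ₜ[ℂ] (X j : S)) =
      f i ⊗ₜ[ℂ] (1 : S) - (1 : S) ⊗ₜ[ℂ] f i)
    (φ : S →ₗ[ℂ] ℂ) (hφ : ∀ p ∈ Ideal.span (Set.range f), φ p = 0)
    (h5 : ∀ d, d ≠ 5 → ∀ p : S, p.IsHomogeneous d → φ p = 0) (h1 : φ A.det = 1)
    (k : ℕ) (g : S) (hg : g.IsHomogeneous k)
    (hgu : ∀ l, k + l = 5 → ∀ u : S, u.IsHomogeneous l → φ (g * u) = 0) :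
    g ∈ Ideal.span (Set.range f) := by
  set M : Matrix (Fin 5) (Fin 5) (S ⊗[ℂ] S) :=
    Matrix.of fun i j => A i j ⊗ₜ[ℂ] (1 : S) + (1 : S) ⊗ₜ[ℂ] A i j with hMdef
  have hW : M.det ∈ W 5 := by
    apply W_det
    intro i j
    have w1 : A i j ⊗ₜ[ℂ] (1 : S) ∈ W 1 :=
      Submodule.subset_span ⟨1, 0, rfl, _, _, hAh i j, isHomogeneous_one _ _, rfl⟩
    have w2 : (1 : S) ⊗ₜ[ℂ] A i j ∈ W 1 :=
      Submodule.subset_span ⟨0, 1, rfl, _, _, isHomogeneous_one _ _, hAh i j, rfl⟩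
    exact add_mem w1 w2
  have hev : ev0 M.det = A.det := by
    rw [AlgHom.map_det]
    congr 1
    ext1 i j
    change ev0 (A i j ⊗ₜ[ℂ] (1 : S) + (1 : S) ⊗ₜ[ℂ] A i j) = A i j
    rw [map_add, ev0_tmul, ev0_tmul, constCoeff_zero (hAh i j) one_pos]
    simp
  have hs : slice φ M.det = 1 := by rw [slice_W φ h5 _ hW, hev, h1, C_1]
  have hmem := slice_K φ f hφ _ (swap_mem f M hM g)
  rw [sub_mul, map_sub, slice_right, hs, mul_one] at hmem
  have hz : ∀ t ∈ W 5, slice φ ((g ⊗ₜ[ℂ] (1 : S)) * t) = 0 := by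
    intro t ht
    unfold W at ht
    induction ht using Submodule.span_induction with
    | zero => simp
    | add a b _ _ ha hb => rw [mul_add, map_add, ha, hb, add_zero]
    | smul c a _ ha => rw [mul_smul_comm, map_smul, ha, smul_zero]
    | mem a ha =>
      obtain ⟨i, j, hij, u, v, hu, hv, rfl⟩ := ha
      have : φ (g * u) = 0 := by
        by_cases h : k + i = 5
        · exact hgu i h u hu
        · exact h5 _ h _ (hg.mul hu)
      simp [this]
  rw [hz _ hW, zero_sub] at hmem
  simpa using hmem

/-- Half the Hessian matrix. -/
noncomputable def hess (F : S) : Matrix (Fin 5) (Fin 5) S :=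
  Matrix.of fun i j => C (1 / 2 : ℂ) * pderiv j (pderiv i F)

lemma hess_hom (F : S) (hF : F.IsHomogeneous 3) (i j : Fin 5) : (hess F i j).IsHomogeneous 1 := by
  have h : (pderiv j (pderiv i F)).IsHomogeneous 1 := hF.pderiv.pderiv
  simpa [hess] using (isHomogeneous_C (Fin 5) (1 / 2 : ℂ)).mul h

lemma hess_mul (F : S) (hF : F.IsHomogeneous 3) (i : Fin 5) :
    ∑ j, hess F i j * X j = pderiv i F := by
  have h : (pderiv i F).IsHomogeneous 2 := hF.pderiv
  have e := h.sum_X_mul_pderiv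
  have : ∑ j, hess F i j * X j = C (1 / 2 : ℂ) * ∑ j, X j * pderiv j (pderiv i F) := by
    rw [Finset.mul_sum]
    exact Finset.sum_congr rfl fun j _ => by simp only [hess, Matrix.of_apply]; ring
  rw [this, e, nsmul_eq_mul, ← mul_assoc]
  have h2 : (C (1 / 2 : ℂ) * ((2 : ℕ) : S)) = 1 := by
    rw [← C_eq_coe_nat, ← C_mul]; norm_num
  rw [h2, one_mul]

lemma hess_lin (F : S) (hF : F.IsHomogeneous 3) : ∃ c : Fin 5 → Fin 5 → Fin 5 → ℂ,
    (∀ i j k, c i j k = c i k j) ∧ ∀ i j, hess F i j = ∑ k, c i j k • (X k : S) := by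
  have h : ∀ i j k, ∃ c, pderiv k (hess F i j) = C c := fun i j k =>
    eq_C_of_deg_zero (hess_hom F hF i j).pderiv
  choose c hc using h
  refine ⟨c, ?_, ?_⟩
  · intro i j k
    apply C_injective (Fin 5) ℂ
    rw [← hc, ← hc]
    simp only [hess, Matrix.of_apply, pderiv_C_mul]
    rw [pderiv_comm']
  · intro i j
    have e := (hess_hom F hF i j).sum_X_mul_pderiv
    rw [one_smul] at e
    rw [← e]
    exact Finset.sum_congr rfl fun k _ => by rw [hc, smul_eq_C_mul, mul_comm]

lemma hess_bez (F : S) (hF : F.IsHomogeneous 3) (i : Fin 5) :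
    ∑ j, (hess F i j ⊗ₜ[ℂ] (1 : S) + (1 : S) ⊗ₜ[ℂ] hess F i j) *
      ((X j : S) ⊗ₜ[ℂ] (1 : S) - (1 : S) ⊗ₜ[ℂ] (X j : S)) =
      pderiv i F ⊗ₜ[ℂ] (1 : S) - (1 : S) ⊗ₜ[ℂ] pderiv i F := by
  obtain ⟨c, hc, hl⟩ := hess_lin F hF
  have hsym : ∑ j, (X j : S) ⊗ₜ[ℂ] hess F i j = ∑ j, hess F i j ⊗ₜ[ℂ] (X j : S) := by
    simp only [hl, TensorProduct.tmul_sum, TensorProduct.sum_tmul]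
    rw [Finset.sum_comm]
    refine Finset.sum_congr rfl fun j _ => Finset.sum_congr rfl fun k _ => ?_
    rw [hc i k j, TensorProduct.tmul_smul, TensorProduct.smul_tmul']
  rw [← hess_mul F hF i]
  have : ∀ j, (hess F i j ⊗ₜ[ℂ] (1 : S) + (1 : S) ⊗ₜ[ℂ] hess F i j) *
      ((X j : S) ⊗ₜ[ℂ] (1 : S) - (1 : S) ⊗ₜ[ℂ] (X j : S)) =
      (hess F i j * X j) ⊗ₜ[ℂ] (1 : S) - (1 : S) ⊗ₜ[ℂ] (hess F i j * X j)
      + ((X j : S) ⊗ₜ[ℂ] hess F i j - hess F i j ⊗ₜ[ℂ] (X j : S)) := by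
    intro j
    simp only [mul_sub, add_mul, Algebra.TensorProduct.tmul_mul_tmul, one_mul, mul_one]
    abel
  simp only [this, Finset.sum_add_distrib, Finset.sum_sub_distrib, hsym, sub_self, add_zero,
    TensorProduct.tmul_sum, TensorProduct.sum_tmul]

lemma rad_mem (F : S) (hs : SmoothForm F) (i : Fin 5) :
    ∃ k, (X i : S) ^ k ∈ jacobianIdeal F := by
  have : (X i : S) ∈ (jacobianIdeal F).radical := by
    rw [← vanishingIdeal_zeroLocus_eq_radical (K := ℂ)]
    intro x hx
    have : x = 0 := hs x fun j => by
      have := hx (pderiv j F) (Ideal.subset_span ⟨j, rfl⟩)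
      simpa [aeval_eq_eval] using this
    simp [this]
  exact this

attribute [local instance] MvPolynomial.gradedAlgebra

lemma comp_mem (F : S) (hF : F.IsHomogeneous 3) (p : S) (hp : p ∈ jacobianIdeal F) (d : ℕ) :
    homogeneousComponent d p ∈ jacobianIdeal F := by
  have h : (jacobianIdeal F).IsHomogeneous (homogeneousSubmodule (Fin 5) ℂ) := by
    apply Ideal.homogeneous_span
    rintro _ ⟨i, rfl⟩
    exact ⟨2, hF.pderiv⟩
  exact (mem_iff_homogeneousComponent_mem h p).mp hp d

lemma hess_det (F : S) (hF : F.IsHomogeneous 3) : (hess F).det.IsHomogeneous 5 := by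
  rw [Matrix.det_apply]
  refine (homogeneousSubmodule (Fin 5) ℂ 5).sum_mem fun σ _ => ?_
  have h1 : (∏ i, hess F (σ i) i).IsHomogeneous 5 := by
    simpa using IsHomogeneous.prod Finset.univ (fun i => hess F (σ i) i) (fun _ => 1)
      fun i _ => hess_hom F hF _ _
  rcases Int.units_eq_one_or (Equiv.Perm.sign σ) with e | e <;> rw [e]
  · simpa using h1
  · simpa using h1

lemma exists_functional (F : S) (hF : F.IsHomogeneous 3) (hs : SmoothForm F) :
    ∃ φ : S →ₗ[ℂ] ℂ, (∀ p ∈ jacobianIdeal F, φ p = 0) ∧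
      (∀ d, d ≠ 5 → ∀ p : S, p.IsHomogeneous d → φ p = 0) ∧ φ (hess F).det = 1 := by
  have hd : (hess F).det ∉ (jacobianIdeal F).restrictScalars ℂ :=
    det_notMem _ _ (hess_mul F hF) (rad_mem F hs)
  obtain ⟨ψ, h1, h2⟩ := Submodule.exists_le_ker_of_notMem hd
  have hdet := hess_det F hF
  refine ⟨(ψ (hess F).det)⁻¹ • (ψ ∘ₗ homogeneousComponent 5), ?_, ?_, ?_⟩
  · intro p hp
    have : ψ (homogeneousComponent 5 p) = 0 := h2 (comp_mem F hF p hp 5)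
    simp [this]
  · intro d hd p hp
    simp [homogeneousComponent_of_mem hp, hd.symm]
  · simp [homogeneousComponent_of_mem hdet, h1]

end MacDual

/-- Macaulay duality for smooth cubic threefolds: `dim S₅/J_{F,5} = 1` and the
multiplication pairing `(S₂/J_{F,2}) × (S₃/J_{F,3}) → S₅/J_{F,5}` is nondegenerate. -/
theorem macaulay_duality_cubic :
    ∀ F ∈ homogeneousSubmodule (Fin 5) ℂ 3, SmoothForm F →
      Module.finrank ℂ (milnorPiece F 5) = 1 ∧
      (∀ a ∈ homogeneousSubmodule (Fin 5) ℂ 2,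
        (∀ B ∈ homogeneousSubmodule (Fin 5) ℂ 3, a * B ∈ jacobianIdeal F) →
          a ∈ jacobianIdeal F) ∧
      (∀ b ∈ homogeneousSubmodule (Fin 5) ℂ 3,
        (∀ a ∈ homogeneousSubmodule (Fin 5) ℂ 2, a * b ∈ jacobianIdeal F) →
          b ∈ jacobianIdeal F) := by
  intro F hF hs
  obtain ⟨φ, hJ, h5, h1⟩ := MacDual.exists_functional F hF hs
  have core := MacDual.core (fun i => pderiv i F) (MacDual.hess F) (MacDual.hess_hom F hF)
    (MacDual.hess_bez F hF) φ hJ h5 h1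
  refine ⟨?_, ?_, ?_⟩
  · have hd := MacDual.hess_det F hF
    refine finrank_eq_one (⟨Submodule.mkQ _ (MacDual.hess F).det, ⟨_, hd, rfl⟩⟩ : milnorPiece F 5)
      ?_ ?_
    · intro h0
      have h2 : Submodule.mkQ (Submodule.restrictScalars ℂ (jacobianIdeal F))
          (MacDual.hess F).det = 0 := congrArg Subtype.val h0
      rw [Submodule.mkQ_apply, Submodule.Quotient.mk_eq_zero] at h2
      have h3 := hJ _ h2
      rw [h1] at h3
      exact one_ne_zero h3
    · rintro ⟨_, g, hg, rfl⟩
      refine ⟨φ g, Subtype.ext ?_⟩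
      change φ g • Submodule.mkQ (Submodule.restrictScalars ℂ (jacobianIdeal F))
          (MacDual.hess F).det = Submodule.mkQ _ g
      rw [← map_smul, ← sub_eq_zero, ← map_sub, Submodule.mkQ_apply,
        Submodule.Quotient.mk_eq_zero]
      refine core 5 _ ((homogeneousSubmodule (Fin 5) ℂ 5).sub_mem
        ((homogeneousSubmodule (Fin 5) ℂ 5).smul_mem _ hd) hg) ?_
      intro l hl u hu
      obtain rfl : l = 0 := by omega
      obtain ⟨c, rfl⟩ := MacDual.eq_C_of_deg_zero hu
      rw [mul_comm, ← smul_eq_C_mul, map_smul, map_sub, map_smul, h1]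
      simp
  · intro a ha hB
    exact core 2 a ha fun l hl u hu => hJ _ (hB u (by obtain rfl : l = 3 := by omega
                                                      exact hu))
  · intro b hb hA
    exact core 3 b hb fun l hl u hu => hJ _ (by
      obtain rfl : l = 2 := by omega
      rw [mul_comm]; exact hA u hu)
end

section
/- Let F ∈ ℂ[x₀,…,x₄] be a smooth cubic form and let G ∈ S_3 be a cubic with G ∈ (J_{F,3})^⊥. Then there exists a quadratic form Q' ∈ S_2 such that (J_{F,5}:Q') = G^⊥; that is, for b ∈ S_3, one has bQ' ∈ J_{F,5} if and only if ⟨b,G⟩ = 0 under the polar pairing. -/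
open MvPolynomial

/-- `J_{F,k} = J_F ∩ S_k`. -/
def Jpart {N : ℕ} (F : MvPolynomial (Fin N) ℂ) (k : ℕ) : Set (MvPolynomial (Fin N) ℂ) :=
  {b | b ∈ jacobianIdeal F ∧ b ∈ homogeneousSubmodule (Fin N) ℂ k}

/-- The polar pairing `⟨P, G⟩ = G(∂/∂x₀,…)P`, as a constant. -/
noncomputable def polarPair {N : ℕ} (P G : MvPolynomial (Fin N) ℂ) : ℂ :=
  constantCoeff (∑ m ∈ G.support, G.coeff m •
    ((List.ofFn fun i : Fin N =>
      ((pderiv i).toLinearMap : Module.End ℂ (MvPolynomial (Fin N) ℂ)) ^ (m i)).prod P))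

/-- `E^⊥ = {G ∈ S₃ : ⟨b, G⟩ = 0 for all b ∈ E}`. -/
def perp {N : ℕ} (E : Set (MvPolynomial (Fin N) ℂ)) : Set (MvPolynomial (Fin N) ℂ) :=
  {G | G ∈ homogeneousSubmodule (Fin N) ℂ 3 ∧ ∀ b ∈ E, polarPair b G = 0}

namespace Mac

abbrev S5 := MvPolynomial (Fin 5) ℂ

lemma mem_sup_span {K : Ideal S5} {g x : S5} :
    x ∈ K ⊔ Ideal.span {g} ↔ ∃ w, x - g * w ∈ K := by
  rw [Submodule.mem_sup]
  constructor
  · rintro ⟨k, hk, z, hz, rfl⟩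
    obtain ⟨w, rfl⟩ := Ideal.mem_span_singleton'.1 hz
    exact ⟨w, by convert hk using 1; ring⟩
  · rintro ⟨w, hw⟩
    exact ⟨_, hw, g * w, Ideal.mul_mem_right _ _ (Ideal.mem_span_singleton_self g), by ring⟩

/-- `g` is regular modulo `K`. -/
def RegMod (K : Ideal S5) (g : S5) : Prop := ∀ u, g * u ∈ K → u ∈ K

/-- The ideal generated by `I` and the first `a` variables. -/
noncomputable def KK (a : ℕ) (I : Ideal S5) : Ideal S5 :=
  I ⊔ Ideal.span (X '' {i : Fin 5 | i.val < a})

lemma KK_zero (I : Ideal S5) : KK 0 I = I := by simp [KK]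

lemma KK_succ (a : Fin 5) (I : Ideal S5) : KK (a.val + 1) I = KK a I ⊔ Ideal.span {X a} := by
  have : {i : Fin 5 | i.val < a.val + 1} = {i : Fin 5 | i.val < a.val} ∪ {a} := by
    ext i
    simp only [Set.mem_ofPred_eq, Set.mem_union, Set.mem_singleton_iff, Fin.ext_iff]
    omega
  rw [KK, KK, this, Set.image_union, Ideal.span_union, Set.image_singleton, sup_assoc]

lemma KK_sup (a : ℕ) (I : Ideal S5) (g : S5) :
    KK a (I ⊔ Ideal.span {g}) = KK a I ⊔ Ideal.span {g} := by
  rw [KK, KK, sup_right_comm]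

/-- Homogeneous ideals, in terms of components. -/
def Homog (I : Ideal S5) : Prop := ∀ x ∈ I, ∀ n, homogeneousComponent n x ∈ I

lemma homog_span (s : Set S5) (h : ∀ x ∈ s, ∃ n, x.IsHomogeneous n) : Homog (Ideal.span s) := by
  intro x hx n
  let _ : GradedAlgebra (homogeneousSubmodule (Fin 5) ℂ) := gradedAlgebra
  refine homogeneousComponent_mem_of_mem (Ideal.homogeneous_span _ s ?_) hx n
  intro x hx
  obtain ⟨n, hn⟩ := h x hx
  exact ⟨n, hn⟩

lemma Homog.sup {I J : Ideal S5} (hI : Homog I) (hJ : Homog J) : Homog (I ⊔ J) := by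
  intro x hx n
  obtain ⟨y, hy, z, hz, rfl⟩ := Submodule.mem_sup.1 hx
  rw [map_add]
  exact add_mem (Ideal.mem_sup_left (hI y hy n)) (Ideal.mem_sup_right (hJ z hz n))

lemma homog_KK (a : ℕ) {I : Ideal S5} (hI : Homog I) : Homog (KK a I) := by
  refine hI.sup (homog_span _ ?_)
  rintro _ ⟨i, -, rfl⟩
  exact ⟨1, isHomogeneous_X _ _⟩

lemma comp_mul {g v : S5} {d : ℕ} (hg : g.IsHomogeneous d) (n : ℕ) :
    homogeneousComponent (d + n) (g * v) = g * homogeneousComponent n v := by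
  conv_lhs => rw [← sum_homogeneousComponent v, Finset.mul_sum, map_sum]
  have h : ∀ i, homogeneousComponent (d + n) (g * homogeneousComponent i v)
      = if i = n then g * homogeneousComponent n v else 0 := by
    intro i
    rw [homogeneousComponent_of_mem (hg.mul (homogeneousComponent_isHomogeneous i v))]
    by_cases hi : i = n
    · simp [hi]
    · rw [if_neg (show ¬ (d + n = d + i) by omega), if_neg hi]
  simp_rw [h]
  rw [Finset.sum_ite_eq']
  split_ifs with hn
  · rfl
  · rw [homogeneousComponent_eq_zero, mul_zero]
    simpa using hn

lemma square {K : Ideal S5} {l g : S5} (hl : RegMod K l)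
    (hg : RegMod (K ⊔ Ideal.span {l}) g) : RegMod (K ⊔ Ideal.span {g}) l := by
  intro u hu
  obtain ⟨w, hw⟩ := mem_sup_span.1 hu
  have h1 : g * w ∈ K ⊔ Ideal.span {l} := by
    refine mem_sup_span.2 ⟨u, ?_⟩
    rw [← neg_mem_iff]; convert hw using 1; ring
  obtain ⟨w', hw'⟩ := mem_sup_span.1 (hg _ h1)
  refine mem_sup_span.2 ⟨w', hl _ ?_⟩
  have := add_mem hw (K.mul_mem_left g hw')
  convert this using 1; ring

/-- The socle of `S/K` is spanned by a single form of degree `b`. -/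
def SocBy (K : Ideal S5) (b : ℕ) : Prop :=
  ∃ e : S5, e.IsHomogeneous b ∧ ∀ u, (∀ i, X i * u ∈ K) → ∃ c : ℂ, u - C c * e ∈ K

lemma exchange {K : Ideal S5} (hK : Homog K) {y z : S5} (hy : y.IsHomogeneous 1)
    (hz : z.IsHomogeneous 2) (ry : RegMod K y) (rz : RegMod K z) {b : ℕ}
    (hym : ∀ v, (∀ i, X i * v ∈ K ⊔ Ideal.span {z}) → y * v ∈ K ⊔ Ideal.span {z})
    (h : SocBy (K ⊔ Ideal.span {y}) b) : SocBy (K ⊔ Ideal.span {z}) (b + 1) := by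
  obtain ⟨e, he, hs⟩ := h
  have key : ∀ v, (∀ i, X i * v ∈ K ⊔ Ideal.span {z}) →
      ∃ (c : ℂ) (w : S5), y * (v - z * w) - C c * (z * e) ∈ K := by
    intro v hv
    obtain ⟨u, hu⟩ := mem_sup_span.1 (hym v hv)
    have hsu : ∀ i, X i * u ∈ K ⊔ Ideal.span {y} := by
      intro i
      obtain ⟨s, hs'⟩ := mem_sup_span.1 (hv i)
      refine mem_sup_span.2 ⟨s, rz _ ?_⟩
      have := sub_mem (K.mul_mem_left y hs') (K.mul_mem_left (X i) hu)
      convert this using 1; ring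
    obtain ⟨c, hc⟩ := hs u hsu
    obtain ⟨w, hw⟩ := mem_sup_span.1 hc
    refine ⟨c, w, ?_⟩
    have := add_mem hu (K.mul_mem_left z hw)
    convert this using 1; ring
  by_cases hex : ∃ e' : S5, e'.IsHomogeneous (b + 1) ∧ y * e' - z * e ∈ K
  · obtain ⟨e', he', h'⟩ := hex
    refine ⟨e', he', fun v hv => ?_⟩
    obtain ⟨c, w, hcw⟩ := key v hv
    refine ⟨c, mem_sup_span.2 ⟨w, ry _ ?_⟩⟩
    have := sub_mem hcw (K.mul_mem_left (C c) h')
    convert this using 1; ring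
  · refine ⟨0, isHomogeneous_zero _ _ _, fun v hv => ⟨0, ?_⟩⟩
    obtain ⟨c, w, hcw⟩ := key v hv
    by_cases hc : c = 0
    · subst hc
      refine mem_sup_span.2 ⟨w, ry _ ?_⟩
      simpa using hcw
    · exfalso
      apply hex
      refine ⟨homogeneousComponent (b + 1) (C c⁻¹ * (v - z * w)),
        homogeneousComponent_isHomogeneous _ _, ?_⟩
      have h2 : y * (C c⁻¹ * (v - z * w)) - z * e ∈ K := by
        have := K.mul_mem_left (C c⁻¹) hcw
        convert this using 1
        have : (C c⁻¹ : S5) * C c = 1 := by rw [← C_mul, inv_mul_cancel₀ hc, C_1]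
        linear_combination (z * e) * this
      have h3 := hK _ h2 (1 + (b + 1))
      rw [map_sub, comp_mul hy, homogeneousComponent_of_mem (hz.mul he),
        if_pos (by omega)] at h3
      exact h3

lemma avoid {E : Type*} [AddCommGroup E] [Module ℂ E] (T : E →ₗ[ℂ] S5)
    (hrad : ∀ i, (X i : S5) ∈ (Ideal.span (Set.range T)).radical)
    (k : ℕ) (K : Fin k → Ideal S5) (hK : ∀ a, ∃ i, RegMod (K a) (X i)) :
    ∃ c : E, ∀ a, RegMod (K a) (T c) := by
  by_contra hcon
  push Not at hcon
  have fin : ∀ a, (associatedPrimes S5 (S5 ⧸ K a)).Finite := fun a => associatedPrimes.finite _ _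
  let ι := Σ a : Fin k, (fin a).toFinset
  let p : ι → Subspace ℂ E := fun j => ((j.2 : Ideal S5).restrictScalars ℂ).comap T
  have hcov : (⋃ j, (p j : Set E)) = Set.univ := by
    rw [Set.eq_univ_iff_forall]
    intro c
    obtain ⟨a, ha⟩ := hcon c
    unfold RegMod at ha
    push Not at ha
    obtain ⟨u, hu, hu'⟩ := ha
    have : T c ∈ ⋃ p ∈ associatedPrimes S5 (S5 ⧸ K a), (p : Set S5) := by
      rw [biUnion_associatedPrimes_eq_zero_divisors]
      refine ⟨Ideal.Quotient.mk _ u, ?_, ?_⟩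
      · rwa [Ne, Ideal.Quotient.eq_zero_iff_mem]
      · rw [← Ideal.Quotient.eq_zero_iff_mem] at hu
        rw [← hu]; rfl
    simp only [Set.mem_iUnion] at this
    obtain ⟨P, hP, hc⟩ := this
    exact Set.mem_iUnion.2 ⟨⟨a, ⟨P, (fin a).mem_toFinset.2 hP⟩⟩, hc⟩
  obtain ⟨⟨a, ⟨P, hP⟩⟩, htop⟩ := Subspace.exists_eq_top_of_iUnion_eq_univ hcov
  have hP' := (fin a).mem_toFinset.1 hP
  have hTP : Ideal.span (Set.range T) ≤ P := by
    rw [Ideal.span_le]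
    rintro _ ⟨c, rfl⟩
    have : c ∈ p ⟨a, ⟨P, hP⟩⟩ := by rw [htop]; trivial
    exact this
  rw [AssociatedPrimes.mem_iff, isAssociatedPrime_iff] at hP'
  obtain ⟨hprime, x, hx⟩ := hP'
  have hXP : ∀ i, (X i : S5) ∈ P := fun i => (hprime.radical_le_iff.2 hTP) (hrad i)
  obtain ⟨u, rfl⟩ := Ideal.Quotient.mk_surjective x
  have hmem : ∀ r, r ∈ P ↔ r * u ∈ K a := by
    intro r
    rw [hx, Submodule.mem_colon_singleton, Submodule.mem_bot,
      ← Ideal.Quotient.eq_zero_iff_mem]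
    rfl
  obtain ⟨i, hi⟩ := hK a
  have := hi u ((hmem _).1 (hXP i))
  exact hprime.ne_top ((Ideal.eq_top_iff_one _).2 ((hmem 1).2 (by simpa using this)))

lemma base_reg (a : Fin 5) : RegMod (KK a ⊥) (X a) := by
  intro u hu
  rw [KK, bot_sup_eq, mem_ideal_span_X_image] at hu ⊢
  intro m hm
  obtain ⟨i, hi, hne⟩ := hu (Finsupp.single a 1 + m) (by
    rw [mem_support_iff, coeff_X_mul]; exact mem_support_iff.1 hm)
  refine ⟨i, hi, ?_⟩
  have : i ≠ a := by rintro rfl; simp at hi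
  simpa [Finsupp.single_apply, this.symm] using hne

lemma base_soc : SocBy (KK 5 ⊥) 0 := by
  refine ⟨1, isHomogeneous_one _ _, fun u _ => ⟨constantCoeff u, ?_⟩⟩
  rw [KK, bot_sup_eq, mem_ideal_span_X_image]
  intro m hm
  by_contra hcon
  push Not at hcon
  have : m = 0 := by ext i; simpa using hcon i (by simp)
  subst this
  simp [constantCoeff_eq] at hm

lemma main_step {E : Type*} [AddCommGroup E] [Module ℂ E] [FiniteDimensional ℂ E]
    (T : E →ₗ[ℂ] S5) (hT : ∀ c, (T c).IsHomogeneous 2)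
    (hrad : ∀ i, (X i : S5) ∈ (Ideal.span (Set.range T)).radical) (b : ℕ) (hb : b ≤ 5) :
    ∃ U : Submodule ℂ E, Module.finrank ℂ U = b ∧
      (∀ a : Fin 5, a.val + b < 5 → RegMod (KK a (Ideal.span (T '' U))) (X a)) ∧
      SocBy (KK (5 - b) (Ideal.span (T '' U))) b := by
  induction b with
  | zero =>
    have : Ideal.span (T '' ((⊥ : Submodule ℂ E) : Set E)) = ⊥ := by simp
    refine ⟨⊥, by simp, ?_, ?_⟩
    · intro a _
      rw [this]; exact base_reg a
    · rw [this]; exact base_soc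
  | succ b ih =>
    obtain ⟨U, hU, hreg, hsoc⟩ := ih (by omega)
    set I := Ideal.span (T '' U) with hI
    have hIh : Homog I := homog_span _ (by rintro _ ⟨c, -, rfl⟩; exact ⟨2, hT c⟩)
    obtain ⟨c, hc⟩ := avoid T hrad (5 - b) (fun a => KK a.val I)
      (fun a => ⟨⟨a.val, by omega⟩, hreg ⟨a.val, by omega⟩ (by have := a.2; simp; omega)⟩)
    have hc' : ∀ a, a + b < 5 → RegMod (KK a I) (T c) := fun a ha => hc ⟨a, by omega⟩
    have hcU : c ∉ U := by
      intro hcU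
      have h1 : (1 : S5) ∈ I := by
        have := hc' 0 (by omega)
        rw [KK_zero] at this
        exact this 1 (by rw [mul_one]; exact Ideal.subset_span ⟨c, hcU, rfl⟩)
      have h2 : I ≤ RingHom.ker (constantCoeff (R := ℂ) (σ := Fin 5)) := by
        rw [hI, Ideal.span_le]
        rintro _ ⟨d, -, rfl⟩
        change constantCoeff (T d) = 0
        rw [constantCoeff_eq]
        exact (hT d).coeff_eq_zero (by simp)
      have := h2 h1
      simp [RingHom.mem_ker] at this
    have hspan : Ideal.span (T '' ((U ⊔ Submodule.span ℂ {c} : Submodule ℂ E) : Set E))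
        = I ⊔ Ideal.span {T c} := by
      apply le_antisymm
      · rw [Ideal.span_le]
        rintro _ ⟨d, hd, rfl⟩
        obtain ⟨y, hy, z, hz, rfl⟩ := Submodule.mem_sup.1 hd
        obtain ⟨r, rfl⟩ := Submodule.mem_span_singleton.1 hz
        rw [map_add, map_smul, smul_eq_C_mul]
        exact add_mem (Ideal.mem_sup_left (Ideal.subset_span ⟨y, hy, rfl⟩))
          (Ideal.mem_sup_right (Ideal.mul_mem_left _ _ (Ideal.mem_span_singleton_self _)))
      · refine sup_le (Ideal.span_mono (Set.image_mono ?_)) ?_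
        · exact fun x hx => Submodule.mem_sup_left hx
        · rw [Ideal.span_singleton_le_iff_mem]
          exact Ideal.subset_span ⟨c, Submodule.mem_sup_right
            (Submodule.mem_span_singleton_self c), rfl⟩
    refine ⟨U ⊔ Submodule.span ℂ {c}, by rw [Submodule.finrank_sup_span_singleton hcU, hU], ?_, ?_⟩
    · intro a ha
      rw [hspan, KK_sup]
      refine square (hreg a (by omega)) ?_
      rw [← KK_succ]
      exact hc' _ (by omega)
    · rw [hspan, KK_sup]
      have h5 : 5 - b = (⟨4 - b, by omega⟩ : Fin 5).val + 1 := by simp; omega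
      rw [h5, KK_succ] at hsoc
      have h6 : 5 - (b + 1) = (⟨4 - b, by omega⟩ : Fin 5).val := by simp only; omega
      rw [h6]
      exact exchange (homog_KK _ hIh) (isHomogeneous_X _ _) (hT c)
        (hreg _ (by simp only; omega)) (hc' _ (by omega)) (fun v hv => hv _) hsoc

lemma soc_jacobian {F : S5} (hF : F.IsHomogeneous 3) (hs : SmoothForm F) :
    Homog (jacobianIdeal F) ∧ (∀ i, (X i : S5) ∈ (jacobianIdeal F).radical) ∧
      SocBy (jacobianIdeal F) 5 := by
  have hd : ∀ i, (pderiv i F).IsHomogeneous 2 := fun i => by simpa using hF.pderiv (i := i)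
  have hrad : ∀ i, (X i : S5) ∈ (jacobianIdeal F).radical := by
    intro i
    rw [← vanishingIdeal_zeroLocus_eq_radical (K := ℂ), mem_vanishingIdeal_iff]
    intro x hx
    have : x = 0 := hs x fun j => by
      have := hx (pderiv j F) (Ideal.subset_span ⟨j, rfl⟩)
      simpa [aeval_eq_eval] using this
    simp [this]
  refine ⟨homog_span _ ?_, hrad, ?_⟩
  · rintro _ ⟨i, rfl⟩
    exact ⟨2, hd i⟩
  let T : (Fin 5 → ℂ) →ₗ[ℂ] S5 := Fintype.linearCombination ℂ (fun i => pderiv i F)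
  have hTa : ∀ c, T c = ∑ i, c i • pderiv i F := fun c => rfl
  have hT : ∀ c, (T c).IsHomogeneous 2 := by
    intro c
    rw [hTa]
    refine IsHomogeneous.sum _ _ _ fun i _ => ?_
    exact (homogeneousSubmodule (Fin 5) ℂ 2).smul_mem _ (hd i)
  have hspan : Ideal.span (Set.range T) = jacobianIdeal F := by
    apply le_antisymm
    · rw [Ideal.span_le]
      rintro _ ⟨c, rfl⟩
      rw [hTa]
      refine Ideal.sum_mem _ fun i _ => ?_
      rw [smul_eq_C_mul]
      exact Ideal.mul_mem_left _ _ (Ideal.subset_span ⟨i, rfl⟩)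
    · rw [jacobianIdeal, Ideal.span_le]
      rintro _ ⟨i, rfl⟩
      refine Ideal.subset_span ⟨Pi.single i 1, ?_⟩
      simp [T]
  obtain ⟨U, hU, -, h⟩ := main_step T hT (by rwa [hspan]) 5 le_rfl
  have : U = ⊤ := Submodule.eq_top_of_finrank_eq (by simp [hU])
  subst this
  rw [Nat.sub_self, KK_zero, Submodule.top_coe, Set.image_univ, hspan] at h
  exact h

lemma soc_deg {J : Ideal S5} (hJ : Homog J) (h : SocBy J 5) {d : ℕ} (hd : d ≠ 5) {u : S5}
    (hu : u.IsHomogeneous d) (hX : ∀ i, X i * u ∈ J) : u ∈ J := by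
  obtain ⟨e, he, hs⟩ := h
  obtain ⟨c, hc⟩ := hs u hX
  have := hJ _ hc d
  rwa [map_sub, homogeneousComponent_C_mul, homogeneousComponent_of_mem hu,
    homogeneousComponent_of_mem he, if_pos rfl, if_neg hd, mul_zero, sub_zero] at this

lemma high_deg {J : Ideal S5} (hJ : Homog J) (h : SocBy J 5)
    (hrad : ∀ i, (X i : S5) ∈ J.radical) {d : ℕ} (hd : 5 < d) {u : S5}
    (hu : u.IsHomogeneous d) : u ∈ J := by
  let m : Ideal S5 := Ideal.span (Set.range X)
  obtain ⟨k, hk⟩ := Ideal.exists_pow_le_of_le_radical_of_fg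
    (show m ≤ J.radical from Ideal.span_le.2 (by rintro _ ⟨i, rfl⟩; exact hrad i))
    (IsNoetherian.noetherian m)
  have key : ∀ k d (u : S5), 5 < d → u.IsHomogeneous d → (∀ p ∈ m ^ k, p * u ∈ J) → u ∈ J := by
    intro k
    induction k with
    | zero =>
      intro d u _ _ hp
      simpa using hp 1 (by simp)
    | succ k ih =>
      intro d u hd hu hp
      refine soc_deg hJ h (by omega) hu fun i => ?_
      refine ih (1 + d) _ (by omega) ((isHomogeneous_X _ i).mul hu) fun p hpk => ?_
      rw [← mul_assoc]
      refine hp _ ?_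
      rw [pow_succ]
      exact Ideal.mul_mem_mul hpk (Ideal.subset_span ⟨i, rfl⟩)
  exact key k d u hd hu fun p hp => J.mul_mem_right _ (hk hp)

/-- The polar pairing as a linear functional of its first argument. -/
noncomputable def polarLin (G : S5) : S5 →ₗ[ℂ] ℂ :=
  (lcoeff ℂ 0) ∘ₗ (∑ m ∈ G.support, G.coeff m •
    (List.ofFn fun i : Fin 5 =>
      ((pderiv i).toLinearMap : Module.End ℂ (MvPolynomial (Fin 5) ℂ)) ^ (m i)).prod)

lemma polarLin_apply (P G : S5) : polarLin G P = polarPair P G := by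
  simp [polarLin, polarPair, constantCoeff_eq, lcoeff_apply]

lemma duality {J : Ideal S5} (hJ : Homog J) (h : SocBy J 5)
    (hrad : ∀ i, (X i : S5) ∈ J.radical) (l : S5 →ₗ[ℂ] ℂ)
    (hl : ∀ b, b.IsHomogeneous 3 → b ∈ J → l b = 0) :
    ∃ Q : S5, Q.IsHomogeneous 2 ∧ ∀ b : S5, b.IsHomogeneous 3 → (b * Q ∈ J ↔ l b = 0) := by
  have h' := h
  obtain ⟨e, he, hs⟩ := h'
  have h5 : ∀ u : S5, u.IsHomogeneous 5 → ∃ c : ℂ, u - C c * e ∈ J := fun u hu =>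
    hs u fun i => high_deg hJ h hrad (d := 1 + 5) (by omega) ((isHomogeneous_X _ i).mul hu)
  have h3 : ∀ b : S5, b.IsHomogeneous 3 → (∀ Q : S5, Q.IsHomogeneous 2 → b * Q ∈ J) → b ∈ J := by
    intro b hb hQ
    refine soc_deg hJ h (by omega) hb fun i => ?_
    refine soc_deg hJ h (d := 1 + 3) (by omega) ((isHomogeneous_X _ i).mul hb) fun j => ?_
    have := hQ (X j * X i) ((isHomogeneous_X _ j).mul (isHomogeneous_X _ i))
    convert this using 1; ring
  by_cases heJ : e ∈ J
  · refine ⟨0, isHomogeneous_zero _ _ _, fun b hb => ?_⟩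
    simp only [mul_zero, zero_mem, true_iff]
    refine hl b hb (h3 b hb fun Q hQ => ?_)
    obtain ⟨c, hc⟩ := h5 _ (hb.mul hQ)
    have := add_mem hc (J.mul_mem_left (C c) heJ)
    simpa using this
  obtain ⟨φ, hφe, hφJ⟩ := Submodule.exists_le_ker_of_notMem (K := ℂ)
    (p := J.restrictScalars ℂ) (v := e) heJ
  have hφ : ∀ u : S5, u.IsHomogeneous 5 → (u ∈ J ↔ φ u = 0) := by
    intro u hu
    refine ⟨fun h => hφJ h, fun h0 => ?_⟩
    obtain ⟨c, hc⟩ := h5 u hu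
    have h1 : φ (u - C c * e) = 0 := hφJ hc
    rw [map_sub, h0, ← smul_eq_C_mul, map_smul, zero_sub, neg_eq_zero, smul_eq_mul] at h1
    have hc0 : c = 0 := (mul_eq_zero.1 h1).resolve_right hφe
    simpa [hc0] using hc
  let S2 := homogeneousSubmodule (Fin 5) ℂ 2
  let S3 := homogeneousSubmodule (Fin 5) ℂ 3
  let B : S2 →ₗ[ℂ] Module.Dual ℂ S3 :=
    ((LinearMap.mul ℂ S5).compr₂ φ).compl₁₂ S2.subtype S3.subtype
  have hB : ∀ (Q : S2) (b : S3), B Q b = φ (Q * b) := fun Q b => rfl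
  have : FiniteDimensional ℂ S2 := Module.Finite.iff_fg.2 (homogeneousSubmodule_fg _ _ 2)
  have hmem : l ∘ₗ S3.subtype ∈ LinearMap.range B := by
    rw [← Subspace.dualCoannihilator_dualAnnihilator_eq (W := LinearMap.range B),
      Submodule.mem_dualAnnihilator]
    intro b hb
    rw [Submodule.mem_dualCoannihilator] at hb
    refine hl b b.2 (h3 b b.2 fun Q hQ => ?_)
    rw [hφ _ (IsHomogeneous.mul b.2 hQ), mul_comm]
    exact hb _ ⟨⟨Q, hQ⟩, rfl⟩
  obtain ⟨Q, hQ⟩ := hmem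
  refine ⟨Q, Q.2, fun b hb => ?_⟩
  rw [hφ _ (hb.mul Q.2), mul_comm]
  have := LinearMap.congr_fun hQ ⟨b, hb⟩
  rw [hB] at this
  simp only [LinearMap.comp_apply, Submodule.subtype_apply] at this
  rw [this]

end Mac

/-- For a smooth cubic `F` and `G ∈ (J_{F,3})^⊥` there is a quadric `Q'` with
`(J_{F,5}:Q') = G^⊥`: for `b ∈ S₃`, `bQ' ∈ J_{F,5}` iff `⟨b, G⟩ = 0`. -/
theorem exists_quadric_colon_eq_perp :
    ∀ F ∈ homogeneousSubmodule (Fin 5) ℂ 3, SmoothForm F →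
      ∀ G ∈ perp (Jpart F 3),
        ∃ Q' ∈ homogeneousSubmodule (Fin 5) ℂ 2,
          ∀ b ∈ homogeneousSubmodule (Fin 5) ℂ 3,
            (b * Q' ∈ jacobianIdeal F ↔ polarPair b G = 0) := by
  intro F hF hs G hG
  obtain ⟨hJ, hrad, hsoc⟩ := Mac.soc_jacobian hF hs
  obtain ⟨Q, hQ, h⟩ := Mac.duality hJ hsoc hrad (Mac.polarLin G) (fun b hb hbJ => by
    rw [Mac.polarLin_apply]; exact hG.2 b ⟨hbJ, hb⟩)
  refine ⟨Q, hQ, fun b hb => ?_⟩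
  rw [h b hb, Mac.polarLin_apply]
end

section
/- (Bertini step.) Let F ∈ ℂ[x₀,…,x₄] be a smooth cubic form and let Q' ∈ S_2 be any quadratic form. Then there exists q ∈ J_{F,2} (the degree-2 part of the Jacobian ideal of F) such that the pair (F, Q'+q) defines a smooth complete intersection surface in ℙ⁴. -/
open MvPolynomial

/-- `(F, Q)` defines a smooth complete intersection: at every nonzero common zero `p` of
`F` and `Q` the gradients `∇F(p)` and `∇Q(p)` are linearly independent. -/
def SmoothCI (F Q : MvPolynomial (Fin 5) ℂ) : Prop :=
  ∀ p : Fin 5 → ℂ, p ≠ 0 → eval p F = 0 → eval p Q = 0 →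
    LinearIndependent ℂ ![fun i => eval p (pderiv i F), fun i => eval p (pderiv i Q)]

open scoped TensorProduct in
/-- Over a countable subring `k` of `ℂ` there are five elements of `ℂ` with dual derivations. -/
lemma exists_dual_derivations (k : Subring ℂ) [Countable k] :
    ∃ a : Fin 5 → ℂ, ∀ i, ∃ D : Derivation k ℂ ℂ, ∀ j, D (a j) = if i = j then 1 else 0 := by
  obtain ⟨s, hs⟩ := exists_isTranscendenceBasis k ℂ
  have hcard : Cardinal.mk ℂ = Cardinal.mk s :=
    IsAlgClosed.cardinal_eq_cardinal_transcendence_basis_of_aleph0_lt' _ hs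
      Cardinal.mk_le_aleph0 (by rw [Cardinal.mk_complex]; exact Cardinal.aleph0_lt_continuum)
  have hinf : Infinite s := by
    rw [Cardinal.infinite_iff, ← hcard, Cardinal.mk_complex]
    exact Cardinal.aleph0_le_continuum
  let P := MvPolynomial s k
  let v : s → ℂ := Subtype.val
  let algP : Algebra P ℂ := (aeval (R := k) v).toAlgebra
  have hmap : ∀ x : P, algebraMap P ℂ x = aeval v x := fun _ => rfl
  have : IsScalarTower k P ℂ := IsScalarTower.of_algebraMap_eq' (by
    ext x; simp [hmap, P, MvPolynomial.algebraMap_eq])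
  have hinj : Function.Injective (algebraMap P ℂ) := hs.1
  have : FaithfulSMul P ℂ := (faithfulSMul_iff_algebraMap_injective P ℂ).2 hinj
  let : Algebra (FractionRing P) ℂ := FractionRing.liftAlgebra P ℂ
  have : IsScalarTower P (FractionRing P) ℂ := FractionRing.isScalarTower_liftAlgebra P ℂ
  have hPalg : Algebra.IsAlgebraic P ℂ := by
    rw [hs.isAlgebraic_iff (S := P)]
    intro t
    have h1 : v t = algebraMap P ℂ (X t) := by simp [hmap, P]
    change IsAlgebraic P (v t)
    rw [h1]
    exact isAlgebraic_algebraMap _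
  have : Algebra.IsAlgebraic (FractionRing P) ℂ := 
    (IsFractionRing.comap_isAlgebraic_iff (A := P) (K := FractionRing P) (C := ℂ)).1 hPalg
  have : CharZero (FractionRing P) :=
    ((algebraMap (FractionRing P) ℂ).charZero_iff (algebraMap (FractionRing P) ℂ).injective).2
      inferInstance
  have : Algebra.FormallyEtale (FractionRing P) ℂ := Algebra.FormallyEtale.of_isSeparable _ _
  have : Algebra.FormallyEtale P (FractionRing P) :=
    Algebra.FormallyEtale.of_isLocalization (nonZeroDivisors P)
  have : Algebra.FormallyEtale P ℂ := Algebra.FormallyEtale.comp P (FractionRing P) ℂ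
  let e : Fin 5 ↪ s := (Fin.valEmbedding).trans (Infinite.natEmbedding s)
  refine ⟨fun i => v (e i), fun i => ?_⟩
  let d : Derivation k P ℂ := mkDerivation k (fun t => if e i = t then (1:ℂ) else 0)
  let f : ℂ ⊗[P] Ω[P⁄k] →ₗ[ℂ] ℂ := LinearMap.liftBaseChange ℂ d.liftKaehlerDifferential
  let g : Ω[ℂ⁄k] →ₗ[ℂ] ℂ :=
    f ∘ₗ (KaehlerDifferential.tensorKaehlerEquivOfFormallyEtale k P ℂ).symm.toLinearMap
  refine ⟨g.compDer (KaehlerDifferential.D k ℂ), fun j => ?_⟩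
  have h1 : v (e j) = algebraMap P ℂ (X (e j)) := by simp [hmap, P]
  simp only [h1]
  simp [g, f, KaehlerDifferential.tensorKaehlerEquivOfFormallyEtale_symm_D_algebraMap, d, P,
    mkDerivation_X]

lemma derivation_eval_map (k : Subring ℂ) (D : Derivation k ℂ ℂ) (p : Fin 5 → ℂ)
    (G : MvPolynomial (Fin 5) k) :
    D (eval p (map (algebraMap k ℂ) G)) =
      ∑ i, eval p (pderiv i (map (algebraMap k ℂ) G)) * D (p i) := by
  induction G using MvPolynomial.induction_on with
  | C a => simp
  | add f g hf hg => simp only [map_add, hf, hg, add_mul, Finset.sum_add_distrib]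
  | mul_X f n hf =>
    simp only [map_mul, map_X, eval_X, Derivation.leibniz, smul_eq_mul, hf, pderiv_mul, map_add,
      add_mul, Finset.sum_add_distrib, Finset.mul_sum, pderiv_X]
    congr 1
    · rw [Finset.sum_eq_single n]
      · simp
      · intro i _ hi
        simp [Pi.single_apply, hi.symm]
      · simp
    · exact Finset.sum_congr rfl fun i _ => by ring

lemma exists_subring (F Q : MvPolynomial (Fin 5) ℂ) :
    ∃ k : Subring ℂ, Countable k ∧ (∃ F₀, map (algebraMap k ℂ) F₀ = F) ∧
      (∃ Q₀, map (algebraMap k ℂ) Q₀ = Q) := by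
  let T : Finset ℂ := F.coeffs ∪ Q.coeffs
  let φ : MvPolynomial T ℤ →+* ℂ := (aeval (R := ℤ) (fun t : T => (t : ℂ))).toRingHom
  have hT : ∀ t ∈ T, t ∈ φ.range := fun t ht => ⟨X ⟨t, ht⟩, by simp [φ]⟩
  have key : ∀ G : MvPolynomial (Fin 5) ℂ, G.coeffs ⊆ T →
      ∃ G₀, map (algebraMap φ.range ℂ) G₀ = G := by
    intro G hG
    have : G ∈ Set.range (map (σ := Fin 5) (algebraMap φ.range ℂ)) := by
      rw [mem_range_map_iff_coeffs_subset]
      intro c hc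
      exact ⟨⟨c, hT c (hG hc)⟩, rfl⟩
    exact this
  have : Countable (MvPolynomial T ℤ) := by
    rw [← Cardinal.mk_le_aleph0_iff]
    refine MvPolynomial.cardinalMk_le_max.trans ?_
    simp
  refine ⟨φ.range, φ.rangeRestrict_surjective.countable, key F ?_, key Q ?_⟩
  · exact Finset.subset_union_left
  · exact Finset.subset_union_right

/-- Bertini step: for a smooth cubic `F` and any quadric `Q'` there is `q ∈ J_{F,2}` such
that `(F, Q' + q)` defines a smooth complete intersection surface. -/
theorem bertini_step :
    ∀ F ∈ homogeneousSubmodule (Fin 5) ℂ 3, SmoothForm F →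
      ∀ Q' ∈ homogeneousSubmodule (Fin 5) ℂ 2,
        ∃ q ∈ Jpart F 2, SmoothCI F (Q' + q) := by
  intro F hF hsm Q' _
  obtain ⟨k, hk, ⟨F₀, hF₀⟩, ⟨Q₀, hQ₀⟩⟩ := exists_subring F Q'
  obtain ⟨a, ha⟩ := exists_dual_derivations k
  refine ⟨∑ j, C (a j) * pderiv j F, ⟨?_, ?_⟩, ?_⟩
  · exact Ideal.sum_mem _ fun j _ => Ideal.mul_mem_left _ _ (Ideal.subset_span ⟨j, rfl⟩)
  · refine Submodule.sum_mem _ fun j _ => ?_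
    rw [mem_homogeneousSubmodule] at hF ⊢
    simpa using (isHomogeneous_C (Fin 5) (a j)).mul (hF.pderiv (i := j))
  · intro p hp hFp hQp
    rw [LinearIndependent.pair_iff]
    by_contra hcon
    have hgrad : ¬ ∀ i, eval p (pderiv i F) = 0 := fun h => hp (hsm p h)
    -- the gradient of `Q` is a multiple of the gradient of `F`
    obtain ⟨l, hl⟩ : ∃ l : ℂ, ∀ i, eval p (pderiv i (Q' + ∑ j, C (a j) * pderiv j F)) =
        l * eval p (pderiv i F) := by
      push Not at hcon
      obtain ⟨s, t, hst, hne⟩ := hcon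
      have hst' : ∀ i, s * eval p (pderiv i F) +
          t * eval p (pderiv i (Q' + ∑ j, C (a j) * pderiv j F)) = 0 := fun i => congrFun hst i
      have ht : t ≠ 0 := by
        rintro rfl
        have hs : s ≠ 0 := fun h => hne h rfl
        exact hgrad fun i => by simpa [hs] using hst' i
      refine ⟨-s / t, fun i => ?_⟩
      have := hst' i
      field_simp
      linear_combination this
    refine hgrad fun i => ?_
    obtain ⟨D, hD⟩ := ha i
    have dF : D (eval p F) = ∑ i, eval p (pderiv i F) * D (p i) := by
      rw [← hF₀]; exact derivation_eval_map k D p F₀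
    have dQ : D (eval p Q') = ∑ i, eval p (pderiv i Q') * D (p i) := by
      rw [← hQ₀]; exact derivation_eval_map k D p Q₀
    have dFj : ∀ j, D (eval p (pderiv j F)) =
        ∑ i, eval p (pderiv i (pderiv j F)) * D (p i) := by
      intro j
      rw [← hF₀, pderiv_map]; exact derivation_eval_map k D p _
    have dT : D (eval p (Q' + ∑ j, C (a j) * pderiv j F)) =
        eval p (pderiv i F) +
        ∑ n, eval p (pderiv n (Q' + ∑ j, C (a j) * pderiv j F)) * D (p n) := by
      simp only [map_add, map_sum, map_mul, eval_C, Derivation.leibniz, smul_eq_mul, hD, dQ, dFj,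
        pderiv_C_mul, add_mul, Finset.sum_add_distrib, Finset.sum_mul, Finset.mul_sum]
      rw [Finset.sum_comm]
      simp [mul_assoc]
      ring
    rw [hQp, map_zero] at dT
    rw [hFp, map_zero] at dF
    simp only [hl, mul_assoc, ← Finset.mul_sum, ← dF] at dT
    simpa using dT.symm
end
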